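/- Let ℓ ∈ {5, 7} and j ≥ 1. If 24n ≡ 1 (mod ℓ^j), then both p(n) ≡ 0 (mod ℓ^{⌊j/2 - 1⌋}) and p_2(2n) ≡ 0 (mod ℓ^{⌊j/2 - 1⌋}); consequently (p(n)+p_2(2n))/2 ≡ 0 (mod ℓ^{⌊j/2-1⌋}) when ⌊j/2-1⌋ ≥ 0. -/

import Mathlib

noncomputable def partp (n : ℕ) : ℕ := Fintype.card (Nat.Partition n)

noncomputable def partp2 (n : ℕ) : ℕ :=
  ∑ k ∈ Finset.range (n + 1), partp k * partp (n - k)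

open PowerSeries Finset

/-- The additive group generated by the `ℓ ^ a * t ^ j` with `W a j`. -/
def weightSpan (ℓ : ℕ) (t : ℤ⟦X⟧) (W : ℕ → ℕ → Prop) : AddSubgroup ℤ⟦X⟧ :=
  AddSubgroup.closure {f | ∃ a j, W a j ∧ f = (ℓ : ℤ⟦X⟧) ^ a * t ^ j}

section weightSpan

variable {ℓ : ℕ} {t : ℤ⟦X⟧}

lemma pow_mul_pow_mem_weightSpan {W : ℕ → ℕ → Prop} {a j : ℕ} (h : W a j) :
    (ℓ : ℤ⟦X⟧) ^ a * t ^ j ∈ weightSpan ℓ t W :=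
  AddSubgroup.subset_closure ⟨a, j, h, rfl⟩

lemma int_mul_mem_weightSpan {W : ℕ → ℕ → Prop} (m : ℤ) {a j : ℕ} (h : W a j) :
    (m : ℤ⟦X⟧) * ((ℓ : ℤ⟦X⟧) ^ a * t ^ j) ∈ weightSpan ℓ t W := by
  rw [← zsmul_eq_mul]
  exact zsmul_mem (pow_mul_pow_mem_weightSpan h) m

lemma weightSpan_map (φ : ℤ⟦X⟧ →+ ℤ⟦X⟧) {W : ℕ → ℕ → Prop} {H : AddSubgroup ℤ⟦X⟧}
    (h : ∀ a j, W a j → φ ((ℓ : ℤ⟦X⟧) ^ a * t ^ j) ∈ H) {f : ℤ⟦X⟧}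
    (hf : f ∈ weightSpan ℓ t W) : φ f ∈ H := by
  have : weightSpan ℓ t W ≤ H.comap φ := by
    refine (AddSubgroup.closure_le _).2 ?_
    rintro _ ⟨a, j, hW, rfl⟩
    exact h a j hW
  exact this hf

lemma mul_mem_weightSpan {W₁ W₂ W₃ : ℕ → ℕ → Prop}
    (h : ∀ a j b k, W₁ a j → W₂ b k → W₃ (a + b) (j + k)) {f g : ℤ⟦X⟧}
    (hf : f ∈ weightSpan ℓ t W₁) (hg : g ∈ weightSpan ℓ t W₂) :
    f * g ∈ weightSpan ℓ t W₃ := by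
  refine weightSpan_map (AddMonoidHom.mulRight g) (fun a j haj ↦ ?_) hf
  refine weightSpan_map (AddMonoidHom.mulLeft ((ℓ : ℤ⟦X⟧) ^ a * t ^ j)) (fun b k hbk ↦ ?_) hg
  have := pow_mul_pow_mem_weightSpan (ℓ := ℓ) (t := t) (h a j b k haj hbk)
  rw [pow_add, pow_add] at this
  simpa [mul_mul_mul_comm] using this

lemma mem_weightSpan_of_pow_mul_mem [NeZero t] {W₁ W₂ : ℕ → ℕ → Prop} {i : ℕ}
    (h : ∀ a j, W₁ a j → ∃ k, j = i + k ∧ W₂ a k) {f : ℤ⟦X⟧}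
    (hf : t ^ i * f ∈ weightSpan ℓ t W₁) : f ∈ weightSpan ℓ t W₂ := by
  have : ∀ g ∈ weightSpan ℓ t W₁, ∃ f ∈ weightSpan ℓ t W₂, g = t ^ i * f := by
    intro g hg
    have := weightSpan_map (AddMonoidHom.id _)
      (H := (weightSpan ℓ t W₂).map (AddMonoidHom.mulLeft (t ^ i))) ?_ hg
    · obtain ⟨f, hf, rfl⟩ := this
      exact ⟨f, hf, rfl⟩
    · intro a j haj
      obtain ⟨k, rfl, hk⟩ := h a j haj
      refine ⟨_, pow_mul_pow_mem_weightSpan hk, ?_⟩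
      simp only [AddMonoidHom.coe_mulLeft, AddMonoidHom.id_apply]
      ring
  obtain ⟨f', hf', e⟩ := this _ hf
  rwa [mul_left_cancel₀ (pow_ne_zero i (NeZero.ne t)) e]

end weightSpan

/-- The operator sending `∑ aₙ Xⁿ` to `∑ a_{ℓ n} Xⁿ`. -/
noncomputable def sieve (ℓ : ℕ) : ℤ⟦X⟧ →+ ℤ⟦X⟧ where
  toFun f := PowerSeries.mk fun n ↦ coeff (ℓ * n) f
  map_zero' := by ext; simp
  map_add' f g := by ext; simp

@[simp]
lemma coeff_sieve (ℓ n : ℕ) (f : ℤ⟦X⟧) : coeff n (sieve ℓ f) = coeff (ℓ * n) f := by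
  simp [sieve]

lemma sieve_expand_mul {ℓ : ℕ} (hℓ : ℓ ≠ 0) (f g : ℤ⟦X⟧) :
    sieve ℓ (expand ℓ hℓ f * g) = f * sieve ℓ g := by
  ext n
  rw [coeff_sieve, coeff_mul, coeff_mul]
  symm
  refine Finset.sum_of_injOn (fun x ↦ (ℓ * x.1, ℓ * x.2)) ?_ ?_ ?_ ?_
  · rintro ⟨a, b⟩ _ ⟨c, d⟩ _ h
    simpa [hℓ] using h
  · rintro ⟨a, b⟩ h
    simp only [SetLike.mem_coe, HasAntidiagonal.mem_antidiagonal] at h ⊢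
    rw [← h, mul_add]
  · rintro ⟨a, b⟩ h h'
    rw [coeff_expand]
    split_ifs with hd
    · obtain ⟨a, rfl⟩ := hd
      rw [HasAntidiagonal.mem_antidiagonal] at h
      obtain ⟨b, rfl⟩ : ℓ ∣ b := (Nat.dvd_add_right (dvd_mul_right ℓ a)).1 (h ▸ dvd_mul_right ℓ n)
      refine absurd ⟨(a, b), ?_, rfl⟩ h'
      rw [← mul_add] at h
      simpa using Nat.eq_of_mul_eq_mul_left (Nat.pos_of_ne_zero hℓ) h
    · simp
  · rintro ⟨a, b⟩ -
    simp

lemma sieve_natCast_mul (ℓ : ℕ) (m : ℕ) (f : ℤ⟦X⟧) :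
    sieve ℓ ((m : ℤ⟦X⟧) * f) = (m : ℤ⟦X⟧) * sieve ℓ f := by
  rw [← nsmul_eq_mul, ← nsmul_eq_mul, map_nsmul]

section contraction

variable {ℓ p : ℕ} {t y : ℤ⟦X⟧}

/-- The weights of the coefficients of `sieve ℓ (y ^ n)` as a polynomial in `t`. -/
def powWeight (p n a j : ℕ) : Prop := p * j ≤ 4 * a + 2 * n + 4 ∧ 2 * n ≤ p * j

/-- The weights of the coefficients of the degree `ℓ` equation satisfied by `y`. -/
def eqnWeight (p n a j : ℕ) : Prop := p * j ≤ 4 * a + 2 * n ∧ 2 * n ≤ p * j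

/-- The weights that are stable under `sieve ℓ`. -/
def stableWeight (p a j : ℕ) : Prop := p * j ≤ 4 * a + 9 ∧ 1 ≤ j

lemma sieve_pow_mem {c : ℕ → ℤ⟦X⟧} (hℓ : ℓ ≠ 0)
    (hc : ∀ i, 1 ≤ i → i ≤ ℓ → c i ∈ weightSpan ℓ t (eqnWeight p i))
    (hsmall : ∀ n, 1 ≤ n → n < ℓ →
      sieve ℓ (y ^ n) - ∑ i ∈ Ico 1 n, c i * sieve ℓ (y ^ (n - i)) ∈ weightSpan ℓ t (powWeight p n))
    (hlarge : ∀ n, ℓ ≤ n → sieve ℓ (y ^ n) = ∑ i ∈ Icc 1 ℓ, c i * sieve ℓ (y ^ (n - i))) (n : ℕ) :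
    sieve ℓ (y ^ n) ∈ weightSpan ℓ t (powWeight p n) := by
  induction n using Nat.strong_induction_on with
  | _ n ih =>
    have key : ∀ i, 1 ≤ i → i ≤ ℓ → i ≤ n → c i * sieve ℓ (y ^ (n - i)) ∈
        weightSpan ℓ t (powWeight p n) := by
      intro i h1 h2 h3
      refine mul_mem_weightSpan ?_ (hc i h1 h2) (ih (n - i) (by omega))
      rintro a j b k ⟨h4, h5⟩ ⟨h6, h7⟩
      constructor <;> rw [mul_add] <;> omega
    rcases Nat.eq_zero_or_pos n with rfl | hn
    · have : sieve ℓ (y ^ 0) = (ℓ : ℤ⟦X⟧) ^ 0 * t ^ 0 := by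
        ext n
        simp [coeff_one, hℓ]
      rw [this]
      exact pow_mul_pow_mem_weightSpan ⟨by simp, by simp⟩
    rcases lt_or_ge n ℓ with h | h
    · rw [← sub_add_cancel (sieve ℓ (y ^ n)) (∑ i ∈ Ico 1 n, c i * sieve ℓ (y ^ (n - i)))]
      refine add_mem (hsmall n hn h) (sum_mem fun i hi ↦ ?_)
      rw [mem_Ico] at hi
      exact key i hi.1 (by omega) (by omega)
    · rw [hlarge n h]
      refine sum_mem fun i hi ↦ ?_
      rw [mem_Icc] at hi
      exact key i hi.1 hi.2 (by omega)

/-- `sieve ℓ` contracts the stable lattice by a factor `ℓ`, and `f ↦ sieve ℓ (y ^ k * f)`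
preserves it. -/
lemma sieve_pow_mul_mem {r : ℕ} (hℓ : ℓ ≠ 0) [NeZero t] (hp : p = 7 ∧ r = 4 ∨ p = 10 ∧ r = 6)
    (hty : expand ℓ hℓ t * t = y ^ r)
    (hy : ∀ n, sieve ℓ (y ^ n) ∈ weightSpan ℓ t (powWeight p n)) :
    (∀ f ∈ weightSpan ℓ t (stableWeight p),
      ∃ g ∈ weightSpan ℓ t (stableWeight p), sieve ℓ f = ℓ * g) ∧
    (∀ k, k ≤ 2 → ∀ f ∈ weightSpan ℓ t (stableWeight p),
      sieve ℓ (y ^ k * f) ∈ weightSpan ℓ t (stableWeight p)) := by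
  have key : ∀ k i, t ^ i * sieve ℓ (y ^ k * t ^ i) = sieve ℓ (y ^ (r * i + k)) := by
    intro k i
    rw [← sieve_expand_mul hℓ, map_pow, pow_add, pow_mul, ← hty]
    congr 1
    ring
  have mem : ∀ k i, 1 ≤ i → k ≤ 2 → sieve ℓ (y ^ k * t ^ i) ∈
      weightSpan ℓ t (fun b j ↦ p * j ≤ 4 * b + (2 * r - p) * i + 2 * k + 4 ∧ 1 ≤ j) := by
    intro k i hi hk
    refine mem_weightSpan_of_pow_mul_mem (i := i) ?_ (key k i ▸ hy (r * i + k))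
    rintro a j ⟨h1, h2⟩
    obtain ⟨m, rfl⟩ : ∃ m, j = i + m := Nat.exists_eq_add_of_le (by
      rcases hp with ⟨rfl, rfl⟩ | ⟨rfl, rfl⟩ <;> omega)
    refine ⟨m, rfl, ?_⟩
    rcases hp with ⟨rfl, rfl⟩ | ⟨rfl, rfl⟩ <;> omega
  constructor
  · intro f hf
    have := weightSpan_map (sieve ℓ)
      (H := (weightSpan ℓ t (stableWeight p)).map (AddMonoidHom.mulLeft (ℓ : ℤ⟦X⟧))) ?_ hf
    · obtain ⟨g, hg, e⟩ := this
      exact ⟨g, hg, e.symm⟩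
    · rintro a i ⟨h1, h2⟩
      rw [← Nat.cast_pow, sieve_natCast_mul, Nat.cast_pow]
      have h3 := mem 0 i h2 (by norm_num)
      rw [pow_zero, one_mul] at h3
      refine weightSpan_map (AddMonoidHom.mulLeft ((ℓ : ℤ⟦X⟧) ^ a)) ?_ h3
      rintro b j ⟨h4, h5⟩
      obtain ⟨m, hm⟩ : ∃ m, a + b = m + 1 := Nat.exists_eq_add_one.2 (by
        rcases hp with ⟨rfl, rfl⟩ | ⟨rfl, rfl⟩ <;> omega)
      refine ⟨(ℓ : ℤ⟦X⟧) ^ m * t ^ j, pow_mul_pow_mem_weightSpan ⟨?_, h5⟩, ?_⟩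
      · rcases hp with ⟨rfl, rfl⟩ | ⟨rfl, rfl⟩ <;> omega
      · simp only [AddMonoidHom.coe_mulLeft]
        rw [← mul_assoc, ← mul_assoc, ← pow_add, hm, pow_succ']
  · intro k hk f hf
    refine weightSpan_map ((sieve ℓ).comp (AddMonoidHom.mulLeft (y ^ k))) ?_ hf
    rintro a i ⟨h1, h2⟩
    simp only [AddMonoidHom.comp_apply, AddMonoidHom.coe_mulLeft]
    rw [mul_left_comm, ← Nat.cast_pow, sieve_natCast_mul, Nat.cast_pow]
    refine weightSpan_map (AddMonoidHom.mulLeft ((ℓ : ℤ⟦X⟧) ^ a)) ?_ (mem k i h2 hk)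
    rintro b j ⟨h4, h5⟩
    simp only [AddMonoidHom.coe_mulLeft]
    rw [← mul_assoc, ← pow_add]
    refine pow_mul_pow_mem_weightSpan ⟨?_, h5⟩
    rcases hp with ⟨rfl, rfl⟩ | ⟨rfl, rfl⟩ <;> omega

end contraction

section iteration

variable {ℓ p δ : ℕ}

/-- Iterating `B ↦ sieve ℓ (sieve ℓ (X ^ d * B))` selects the coefficients in an arithmetic
progression. -/
lemma coeff_iterate_sieve (hℓ : ℓ ≠ 0) (P : ℤ⟦X⟧) (d : ℕ) (m : ℕ) : ∀ n N : ℕ,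
    N + d * ∑ i ∈ range m, ℓ ^ (2 * i) = ℓ ^ (2 * m) * n →
    coeff n ((fun B ↦ sieve ℓ (sieve ℓ (X ^ d * B)))^[m] P) = coeff N P := by
  induction m with
  | zero => intro n N h; simp_all
  | succ m ih =>
    intro n N h
    rw [Function.iterate_succ_apply', coeff_sieve, coeff_sieve, coeff_X_pow_mul']
    rw [sum_range_succ, mul_add, ← add_assoc] at h
    have e : ℓ ^ (2 * (m + 1)) * n = ℓ ^ (2 * m) * (ℓ * (ℓ * n)) := by ring
    rw [e] at h
    have hle : d ≤ ℓ * (ℓ * n) := by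
      refine Nat.le_of_mul_le_mul_left (c := ℓ ^ (2 * m)) ?_ (pow_pos (Nat.pos_of_ne_zero hℓ) _)
      rw [← h, mul_comm (ℓ ^ (2 * m)) d]
      omega
    rw [if_pos hle]
    apply ih
    rw [Nat.mul_sub, ← h, mul_comm d (ℓ ^ (2 * m)), Nat.add_sub_cancel]

lemma pow_dvd_coeff_of_contraction {t y G P : ℤ⟦X⟧} {k : ℕ} (hℓ : ℓ ≠ 0)
    (hδ : ℓ ^ 2 = 24 * δ + 1)
    (hk1 : 1 ≤ k) (hk : k ≤ 2) (hGP : G * P = 1)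
    (hy : y ^ k = X ^ (δ * k) * expand ℓ hℓ (expand ℓ hℓ G) * P)
    (hpow : sieve ℓ (y ^ k) ∈ weightSpan ℓ t (powWeight p k))
    (h1 : ∀ f ∈ weightSpan ℓ t (stableWeight p),
      ∃ g ∈ weightSpan ℓ t (stableWeight p), sieve ℓ f = ℓ * g)
    (h2 : ∀ f ∈ weightSpan ℓ t (stableWeight p),
      sieve ℓ (y ^ k * f) ∈ weightSpan ℓ t (stableWeight p))
    {N j : ℕ} (hN : 24 * N ≡ k [MOD ℓ ^ j]) : (ℓ : ℤ) ^ (j / 2) ∣ coeff N P := by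
  set B : ℕ → ℤ⟦X⟧ := fun m ↦ (fun B ↦ sieve ℓ (sieve ℓ (X ^ (δ * k) * B)))^[m] P with hB
  have hstep : ∀ m, G * B (m + 1) = sieve ℓ (sieve ℓ (y ^ k * (G * B m))) := by
    intro m
    have : y ^ k * (G * B m) =
        expand ℓ hℓ (expand ℓ hℓ G) * (X ^ (δ * k) * B m) := by
      rw [hy]
      linear_combination (X ^ (δ * k) * expand ℓ hℓ (expand ℓ hℓ G) * B m) * hGP
    rw [this, sieve_expand_mul, sieve_expand_mul, hB]
    simp only [Function.iterate_succ_apply']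
  have hbase : sieve ℓ (y ^ k) ∈ weightSpan ℓ t (stableWeight p) := by
    refine weightSpan_map (AddMonoidHom.id _) ?_ hpow
    rintro a j ⟨h3, h4⟩
    refine pow_mul_pow_mem_weightSpan ⟨by omega, Nat.pos_of_ne_zero ?_⟩
    rintro rfl
    omega
  have hmem : ∀ m, ∃ g ∈ weightSpan ℓ t (stableWeight p),
      G * B (m + 1) = (ℓ : ℤ⟦X⟧) ^ (m + 1) * g := by
    intro m
    induction m with
    | zero =>
      obtain ⟨g, hg, e⟩ := h1 _ hbase
      refine ⟨g, hg, ?_⟩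
      rw [hstep, hB]
      simp [hGP, e]
    | succ m ih =>
      obtain ⟨g, hg, e⟩ := ih
      obtain ⟨g', hg', e'⟩ := h1 _ (h2 g hg)
      refine ⟨g', hg', ?_⟩
      rw [hstep, e, mul_left_comm, ← Nat.cast_pow, sieve_natCast_mul, sieve_natCast_mul, e']
      push_cast
      ring
  have hdvd : ∀ m n, (ℓ : ℤ) ^ m ∣ coeff n (B m) := by
    intro m n
    rcases m with _ | m
    · simp
    obtain ⟨g, -, e⟩ := hmem m
    have : B (m + 1) = ((ℓ : ℤ) ^ (m + 1)) • (P * g) := by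
      rw [zsmul_eq_mul]
      push_cast
      linear_combination P * e - B (m + 1) * hGP
    rw [this, map_zsmul]
    exact ⟨_, by rw [smul_eq_mul]⟩
  set m := j / 2 with hm
  have hD : 24 * (δ * ∑ i ∈ range m, ℓ ^ (2 * i)) + 1 = ℓ ^ (2 * m) := by
    clear_value m
    clear hm
    induction m with
    | zero => simp
    | succ m ih =>
      rw [sum_range_succ, mul_add 2, pow_add, mul_one, hδ]
      linear_combination ih
  have hco : Nat.Coprime (ℓ ^ (2 * m)) 24 := by
    apply Nat.Coprime.pow_left
    have : Nat.Coprime (ℓ ^ 2) 24 := by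
      rw [hδ]
      simp
    exact Nat.Coprime.coprime_dvd_left (dvd_pow_self ℓ two_ne_zero) this
  have hd : ℓ ^ (2 * m) ∣ N + δ * k * ∑ i ∈ range m, ℓ ^ (2 * i) := by
    refine hco.dvd_of_dvd_mul_right ?_
    have hN' : 24 * N ≡ k [MOD ℓ ^ (2 * m)] := hN.of_dvd (pow_dvd_pow _ (by omega))
    have := hN'.add_right (24 * (δ * k * ∑ i ∈ range m, ℓ ^ (2 * i)))
    have e : k + 24 * (δ * k * ∑ i ∈ range m, ℓ ^ (2 * i)) = ℓ ^ (2 * m) * k := by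
      rw [← hD]; ring
    rw [e, ← mul_add] at this
    rw [mul_comm _ 24]
    exact Nat.modEq_zero_iff_dvd.1 (this.trans (Nat.modEq_zero_iff_dvd.2 (dvd_mul_right _ _)))
  obtain ⟨n, hn⟩ := hd
  rw [← coeff_iterate_sieve hℓ P (δ * k) m n N hn]
  exact hdvd m n

end iteration

section partitions

/-- The generating function of the partition numbers. -/
noncomputable def partitionSeries : ℤ⟦X⟧ := PowerSeries.mk fun n ↦ (partp n : ℤ)

open scoped PowerSeries.WithPiTopology in
lemma pentagonalSeries_mul_partitionSeries : pentagonalSeries ℤ * partitionSeries = 1 := by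
  have h1 := PowerSeries.WithPiTopology.hasProd_one_sub_X_pow ℤ
  have h2 := Nat.Partition.hasProd_powerSeriesMk_card_restricted ℤ (fun _ ↦ True)
  have h3 : (PowerSeries.mk fun n ↦ ((Nat.Partition.restricted n fun _ ↦ True).card : ℤ)) =
      partitionSeries := by
    ext n
    simp [partitionSeries, partp, Nat.Partition.restricted]
  rw [h3] at h2
  refine (h1.mul h2).unique ?_
  convert hasProd_one using 2 with i
  simp only [if_true, pow_mul]
  rw [mul_comm]
  exact PowerSeries.WithPiTopology.tsum_pow_mul_one_sub_of_constantCoeff_eq_zero (by simp)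

lemma coeff_partitionSeries (n : ℕ) : coeff n partitionSeries = (partp n : ℤ) := by
  simp [partitionSeries]

lemma coeff_partitionSeries_sq (n : ℕ) : coeff n (partitionSeries ^ 2) = (partp2 n : ℤ) := by
  rw [pow_two, coeff_mul, Finset.Nat.sum_antidiagonal_eq_sum_range_succ
    (fun i j ↦ coeff i partitionSeries * coeff j partitionSeries)]
  simp [partitionSeries, partp2]

lemma even_partp_add_partp2 (n : ℕ) : Even (partp n + partp2 (2 * n)) := by
  have h : partp2 (2 * n) = 2 * ∑ k ∈ range n, partp k * partp (2 * n - k) + partp n * partp n := by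
    have h2 : ∑ k ∈ range n, partp (n + 1 + k) * partp (2 * n - (n + 1 + k)) =
        ∑ k ∈ range n, partp k * partp (2 * n - k) := by
      rw [← sum_range_reflect]
      refine sum_congr rfl fun k hk ↦ ?_
      have := Finset.mem_range.mp hk
      rw [mul_comm, show 2 * n - (n + 1 + (n - 1 - k)) = k by lia,
        show n + 1 + (n - 1 - k) = 2 * n - k by lia]
    rw [partp2, show 2 * n + 1 = (n + 1) + n by ring, sum_range_add, sum_range_succ, h2,
      show 2 * n - n = n by lia]
    ring
  rw [h, Nat.even_add, Nat.even_add]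
  simp [Nat.even_mul]

end partitions

section jacobi

/-- The finite product `(1 - X) (1 - X ^ 2) ⋯ (1 - X ^ n)`. -/
noncomputable def eulerProd (n : ℕ) : ℤ⟦X⟧ := ∏ i ∈ range n, (1 - X ^ (i + 1))

lemma eulerProd_succ (n : ℕ) : eulerProd (n + 1) = eulerProd n * (1 - X ^ (n + 1)) :=
  prod_range_succ _ _

lemma constantCoeff_eulerProd (n : ℕ) : constantCoeff (eulerProd n) = 1 := by
  simp [eulerProd]

lemma X_pow_dvd_eulerProd_sub {m n : ℕ} (h : m ≤ n) :
    (X : ℤ⟦X⟧) ^ (m + 1) ∣ eulerProd n - eulerProd m := by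
  induction n, h using Nat.le_induction with
  | base => simp
  | succ n hn ih =>
    have h1 : (X : ℤ⟦X⟧) ^ (m + 1) ∣ X ^ (n + 1) := pow_dvd_pow _ (by lia)
    have h2 : eulerProd (n + 1) - eulerProd m =
        (eulerProd n - eulerProd m) - X ^ (n + 1) * eulerProd n := by
      rw [eulerProd_succ]; ring
    rw [h2]
    exact dvd_sub ih (h1.mul_right _)

lemma X_pow_dvd_pentagonalSeries_sub (n : ℕ) :
    (X : ℤ⟦X⟧) ^ (n + 1) ∣ pentagonalSeries ℤ - eulerProd n := by
  rw [X_pow_dvd_iff]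
  intro i hi
  obtain ⟨s, hs⟩ := Filter.eventually_atTop.mp (coeff_prod_one_sub_X_pow_eventually_eq ℤ i)
  obtain ⟨M, hM⟩ := s.exists_nat_subset_range
  have h1 := hs (range (max M i)) (hM.trans (by simp))
  have h2 := X_pow_dvd_iff.mp (X_pow_dvd_eulerProd_sub (le_max_right M i)) i (by lia)
  have h3 := X_pow_dvd_iff.mp (X_pow_dvd_eulerProd_sub (show i ≤ n by lia)) i (by lia)
  rw [map_sub] at h2 h3 ⊢
  rw [← h1]
  change coeff i (eulerProd _) - _ = 0
  lia

/-- The inverse of `eulerProd`, with a shift in the index so as to be `0` at `0`. -/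
noncomputable def eulerInv : ℕ → ℤ⟦X⟧
  | 0 => 0
  | n + 1 => invOfUnit (eulerProd n) 1

lemma eulerProd_mul_eulerInv (n : ℕ) : eulerProd n * eulerInv (n + 1) = 1 :=
  mul_invOfUnit _ 1 (by simp [constantCoeff_eulerProd])

lemma eulerInv_eq (n : ℕ) : eulerInv n = (1 - X ^ n) * eulerInv (n + 1) := by
  cases n with
  | zero => simp [eulerInv]
  | succ n =>
    have h1 := eulerProd_mul_eulerInv n
    have h2 := eulerProd_mul_eulerInv (n + 1)
    rw [eulerProd_succ] at h2
    linear_combination (-eulerInv (n + 1)) * h2 + (1 - X ^ (n + 1)) * eulerInv (n + 2) * h1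

/-- The signed triangular power `(-1) ^ k * X ^ (k (k + 1) / 2)`. -/
noncomputable def triTerm (k : ℕ) : ℤ⟦X⟧ := (-1) ^ k * X ^ (k + 1).choose 2

lemma triTerm_succ (k : ℕ) : triTerm (k + 1) = -X ^ (k + 1) * triTerm k := by
  rw [triTerm, triTerm, Nat.choose_succ_succ' (k + 1) 1, Nat.choose_one_right]
  ring

/-- The coefficient of `z ^ k` in `(1 - z) ∏ (1 - z X ^ i) (1 - z⁻¹ X ^ i)`, up to sign. -/
noncomputable def tripleCoeff (n k : ℕ) : ℤ⟦X⟧ :=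
  triTerm k * eulerProd (2 * n + 1) * eulerInv (n + 1 - k) * eulerInv (n + k + 2)

lemma tripleCoeff_zero (n : ℕ) : tripleCoeff (n + 1) 0 =
    (1 + X ^ (n + 1) + X ^ (2 * n + 2)) * tripleCoeff n 0 - X ^ (n + 1) * tripleCoeff n 1 := by
  simp only [tripleCoeff, triTerm_succ, Nat.sub_zero, Nat.add_sub_cancel, add_zero, zero_add]
  rw [show 2 * (n + 1) + 1 = 2 * n + 1 + 1 + 1 by ring, eulerProd_succ, eulerProd_succ,
    eulerInv_eq n, eulerInv_eq (n + 1), eulerInv_eq (n + 2)]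
  ring

lemma tripleCoeff_succ (n k : ℕ) : tripleCoeff (n + 1) (k + 1) =
    (1 + X ^ (2 * n + 2)) * tripleCoeff n (k + 1) -
      X ^ (n + 1) * (tripleCoeff n k + tripleCoeff n (k + 2)) := by
  rcases lt_or_ge n k with h | h
  · simp only [tripleCoeff, show n + 1 - k = 0 by lia, show n + 1 + 1 - (k + 1) = 0 by lia,
      show n + 1 - (k + 1) = 0 by lia, show n + 1 - (k + 2) = 0 by lia, eulerInv]
    ring
  · obtain ⟨m, rfl⟩ := Nat.exists_eq_add_of_le h
    simp only [tripleCoeff, triTerm_succ, show k + m + 1 - k = m + 1 by lia,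
      show k + m + 1 + 1 - (k + 1) = m + 1 by lia, show k + m + 1 - (k + 1) = m by lia]
    rw [show 2 * (k + m + 1) + 1 = 2 * (k + m) + 1 + 1 + 1 by ring, eulerProd_succ,
      eulerProd_succ, show k + m + (k + 1) + 2 = k + m + k + 3 by ring,
      show k + m + (k + 2) + 2 = k + m + k + 3 + 1 by ring,
      show k + m + 1 + (k + 1) + 2 = k + m + k + 3 + 1 by ring,
      eulerInv_eq (k + m + k + 2), eulerInv_eq (k + m + k + 3)]
    cases m with
    | zero =>
      simp only [show k + 0 + 1 - (k + 2) = 0 by lia, eulerInv]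
      ring
    | succ m =>
      rw [show k + (m + 1) + 1 - (k + 2) = m by lia, eulerInv_eq m, eulerInv_eq (m + 1)]
      ring

lemma sum_tripleCoeff_succ (n N : ℕ) :
    ∑ k ∈ range (N + 1), (2 * k + 1 : ℤ⟦X⟧) * tripleCoeff (n + 1) k =
      (1 - X ^ (n + 1)) ^ 2 * ∑ k ∈ range (N + 1), (2 * k + 1 : ℤ⟦X⟧) * tripleCoeff n k +
      X ^ (n + 1) *
        ((2 * N + 3 : ℤ⟦X⟧) * tripleCoeff n N - (2 * N + 1 : ℤ⟦X⟧) * tripleCoeff n (N + 1)) := by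
  induction N with
  | zero => simp [tripleCoeff_zero]; ring
  | succ N ih =>
    rw [sum_range_succ, ih, sum_range_succ _ (N + 1), tripleCoeff_succ]
    push_cast
    ring

lemma tripleCoeff_eq_zero {n k : ℕ} (h : n < k) : tripleCoeff n k = 0 := by
  simp [tripleCoeff, show n + 1 - k = 0 by lia, eulerInv]

lemma sum_tripleCoeff {n N : ℕ} (h : n ≤ N) :
    ∑ k ∈ range (N + 1), (2 * k + 1 : ℤ⟦X⟧) * tripleCoeff n k = eulerProd n ^ 2 := by
  induction n with
  | zero =>
    rw [sum_eq_single 0 (fun k _ hk ↦ by rw [tripleCoeff_eq_zero (by lia), mul_zero]) (by simp)]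
    have h1 := eulerProd_mul_eulerInv 0
    have h2 := eulerProd_mul_eulerInv 1
    simp only [eulerProd, range_zero, prod_empty, zero_add, prod_range_one, one_mul] at h1 h2
    simpa [tripleCoeff, triTerm, eulerProd, h1] using h2
  | succ n ih =>
    rw [sum_tripleCoeff_succ, ih (by lia), tripleCoeff_eq_zero (show n < N by lia),
      tripleCoeff_eq_zero (show n < N + 1 by lia), eulerProd_succ]
    ring

lemma X_pow_dvd_eulerProd_mul_eulerInv_sub_one {m n : ℕ} (h : m ≤ n) :
    (X : ℤ⟦X⟧) ^ (m + 1) ∣ eulerProd n * eulerInv (m + 1) - 1 := by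
  rw [← eulerProd_mul_eulerInv m, ← sub_mul]
  exact (X_pow_dvd_eulerProd_sub h).mul_right _

lemma le_choose_two (k : ℕ) : k ≤ (k + 1).choose 2 := by
  rw [Nat.choose_succ_succ' k 1, Nat.choose_one_right]
  lia

lemma X_pow_dvd_eulerProd_mul_tripleCoeff_sub {n k : ℕ} (h : k ≤ n) :
    (X : ℤ⟦X⟧) ^ (n + 1) ∣ eulerProd n * tripleCoeff n k - triTerm k := by
  have h1 : (X : ℤ⟦X⟧) ^ (n + 1) ∣ eulerProd n * triTerm k * eulerInv (n + 1 - k) - triTerm k := by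
    obtain ⟨m, rfl⟩ := Nat.exists_eq_add_of_le h
    obtain ⟨f, hf⟩ := X_pow_dvd_eulerProd_mul_eulerInv_sub_one (Nat.le_add_left m k)
    have h2 : (X : ℤ⟦X⟧) ^ (k + m + 1) ∣ X ^ ((k + 1).choose 2 + (m + 1)) :=
      pow_dvd_pow _ (by have := le_choose_two k; lia)
    rw [show k + m + 1 - k = m + 1 by lia]
    have h3 : eulerProd (k + m) * triTerm k * eulerInv (m + 1) - triTerm k =
        X ^ ((k + 1).choose 2 + (m + 1)) * ((-1) ^ k * f) := by
      rw [triTerm]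
      linear_combination ((-1) ^ k * X ^ (k + 1).choose 2) * hf
    rw [h3]
    exact h2.mul_right _
  have h2 : (X : ℤ⟦X⟧) ^ (n + 1) ∣ eulerProd (2 * n + 1) * eulerInv (n + k + 2) - 1 :=
    (pow_dvd_pow _ (by lia)).trans
      (X_pow_dvd_eulerProd_mul_eulerInv_sub_one (show n + k + 1 ≤ 2 * n + 1 by lia))
  have h3 : eulerProd n * tripleCoeff n k - triTerm k =
      (eulerProd (2 * n + 1) * eulerInv (n + k + 2) - 1) *
        (eulerProd n * triTerm k * eulerInv (n + 1 - k)) +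
      (eulerProd n * triTerm k * eulerInv (n + 1 - k) - triTerm k) := by
    rw [tripleCoeff]; ring
  rw [h3]
  exact dvd_add (h2.mul_right _) h1

/-- **Jacobi's identity** for the cube of the Euler product. -/
theorem X_pow_dvd_pentagonalSeries_pow_three_sub (n : ℕ) : (X : ℤ⟦X⟧) ^ (n + 1) ∣
    pentagonalSeries ℤ ^ 3 - ∑ k ∈ range (n + 1), (2 * k + 1 : ℤ⟦X⟧) * triTerm k := by
  have h1 : (X : ℤ⟦X⟧) ^ (n + 1) ∣ pentagonalSeries ℤ ^ 3 - eulerProd n ^ 3 :=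
    (X_pow_dvd_pentagonalSeries_sub n).trans (sub_dvd_pow_sub_pow _ _ _)
  have h2 : eulerProd n ^ 3 - ∑ k ∈ range (n + 1), (2 * k + 1 : ℤ⟦X⟧) * triTerm k =
      ∑ k ∈ range (n + 1), (2 * k + 1 : ℤ⟦X⟧) * (eulerProd n * tripleCoeff n k - triTerm k) := by
    simp only [mul_sub, sum_sub_distrib]
    rw [pow_succ, ← sum_tripleCoeff le_rfl, sum_mul]
    congr 1
    exact sum_congr rfl fun k _ ↦ by ring
  rw [← sub_add_sub_cancel _ (eulerProd n ^ 3), h2]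
  refine dvd_add h1 (dvd_sum fun k hk ↦ Dvd.dvd.mul_left ?_ _)
  exact X_pow_dvd_eulerProd_mul_tripleCoeff_sub (by simpa [Nat.lt_succ_iff] using hk)

lemma coeff_pentagonalSeries_pow_three (n : ℕ) : coeff n (pentagonalSeries ℤ ^ 3) =
    ∑ k ∈ range (n + 1), if (k + 1).choose 2 = n then (-1) ^ k * (2 * k + 1 : ℤ) else 0 := by
  have h := X_pow_dvd_iff.mp (X_pow_dvd_pentagonalSeries_pow_three_sub n) n (by lia)
  rw [map_sub, sub_eq_zero] at h
  rw [h, map_sum]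
  refine sum_congr rfl fun k _ ↦ ?_
  have h1 : (2 * k + 1 : ℤ⟦X⟧) * triTerm k =
      C ((-1) ^ k * (2 * k + 1 : ℤ)) * X ^ (k + 1).choose 2 := by
    rw [triTerm]
    simp
    ring
  rw [h1, coeff_C_mul, coeff_X_pow]
  simp [eq_comm]

end jacobi

section residues

/-- The series `f` is supported on exponents congruent to `r` modulo `m`. -/
def HasResidue {R : Type*} [Semiring R] (m r : ℕ) (f : R⟦X⟧) : Prop :=
  ∀ n, coeff n f ≠ 0 → n % m = r % m

lemma HasResidue.mul {R : Type*} [Semiring R] {m r s : ℕ} {f g : R⟦X⟧} (hf : HasResidue m r f)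
    (hg : HasResidue m s g) : HasResidue m (r + s) (f * g) := by
  intro n hn
  rw [coeff_mul] at hn
  obtain ⟨⟨a, b⟩, hab, h⟩ := exists_ne_zero_of_sum_ne_zero hn
  rw [← HasAntidiagonal.mem_antidiagonal.mp hab]
  exact Nat.ModEq.add (hf a (left_ne_zero_of_mul h)) (hg b (right_ne_zero_of_mul h))

/-- The part of a series supported on exponents congruent to `r` modulo `m`. -/
noncomputable def residuePart (m r : ℕ) : ℤ⟦X⟧ →+ ℤ⟦X⟧ where
  toFun f := PowerSeries.mk fun n ↦ if n % m = r % m then coeff n f else 0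
  map_zero' := by ext; simp
  map_add' f g := by ext n; by_cases h : n % m = r % m <;> simp [h]

lemma coeff_residuePart (m r n : ℕ) (f : ℤ⟦X⟧) :
    coeff n (residuePart m r f) = if n % m = r % m then coeff n f else 0 := by
  simp [residuePart]

lemma hasResidue_residuePart (m r : ℕ) (f : ℤ⟦X⟧) : HasResidue m r (residuePart m r f) := by
  intro n hn
  by_contra h
  simp [coeff_residuePart, h] at hn

lemma HasResidue.residuePart_eq {m s : ℕ} {f : ℤ⟦X⟧} (h : HasResidue m s f) (r : ℕ) :
    residuePart m r f = if s % m = r % m then f else 0 := by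
  ext n
  rw [coeff_residuePart]
  by_cases hn : coeff n f = 0
  · split_ifs <;> simp [hn]
  · rw [h n hn]
    split_ifs <;> simp

lemma residuePart_mul_mul {m a b c : ℕ} {f g h : ℤ⟦X⟧} (hf : HasResidue m a f)
    (hg : HasResidue m b g) (hh : HasResidue m c h) (r : ℕ) :
    residuePart m r (f * g * h) = if (a + b + c) % m = r % m then f * g * h else 0 :=
  ((hf.mul hg).mul hh).residuePart_eq r

lemma residuePart_eq_of_lacunary {ι : Type*} {ℓ d : ℕ} {c : ℤ} {f : ℤ⟦X⟧} {e : ι → ℕ} {a : ι → ℤ}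
    (hℓ : ℓ ≠ 0) (he : ∀ i, coeff (e i) f = a i) (h0 : ∀ n, n ∉ Set.range e → coeff n f = 0)
    (σ : ι → ι) (hσ : ∀ i, e (σ i) = d + ℓ * (ℓ * e i)) (ha : ∀ i, a (σ i) = c * a i)
    (hres : ∀ k, e k % ℓ = d % ℓ → ∃ i, k = σ i) :
    residuePart ℓ d f = (c : ℤ⟦X⟧) * (X ^ d * expand ℓ hℓ (expand ℓ hℓ f)) := by
  have hc : (c : ℤ⟦X⟧) = C c := by simp
  have h1 (m : ℕ) : coeff (d + ℓ * (ℓ * m)) (X ^ d * expand ℓ hℓ (expand ℓ hℓ f)) = coeff m f := by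
    rw [add_comm, coeff_X_pow_mul, coeff_expand_mul, coeff_expand_mul]
  have h2 (n : ℕ) (hn : ∀ m, n ≠ d + ℓ * (ℓ * m)) :
      coeff n (X ^ d * expand ℓ hℓ (expand ℓ hℓ f)) = 0 := by
    rw [coeff_X_pow_mul']
    split_ifs with h
    · obtain ⟨k, rfl⟩ := Nat.exists_eq_add_of_le h
      rw [Nat.add_sub_cancel_left, coeff_expand]
      split_ifs with h3
      · obtain ⟨k, rfl⟩ := h3
        rw [Nat.mul_div_cancel_left _ (by lia)]
        refine coeff_expand_of_not_dvd _ _ _ fun ⟨m, hm⟩ ↦ hn m (by rw [hm])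
      · rfl
    · rfl
  ext n
  rw [coeff_residuePart, hc, coeff_C_mul]
  by_cases hn : n ∈ Set.range e
  · obtain ⟨k, rfl⟩ := hn
    split_ifs with hk
    · obtain ⟨i, rfl⟩ := hres k hk
      rw [he, hσ, h1, he, ha]
    · rw [h2, mul_zero]
      rintro m hm
      exact hk (by simp [hm])
  · rw [h0 n hn, ite_self]
    by_cases hm : ∃ m, n = d + ℓ * (ℓ * m)
    · obtain ⟨m, rfl⟩ := hm
      rw [h1, h0 m, mul_zero]
      rintro ⟨i, rfl⟩
      exact hn ⟨σ i, hσ i⟩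
    · rw [h2 n (by simpa using hm), mul_zero]

lemma strictMono_choose_two : StrictMono fun k : ℕ ↦ (k + 1).choose 2 :=
  strictMono_nat_of_lt_succ fun k ↦ by
    rw [Nat.choose_succ_succ' (k + 1) 1, Nat.choose_one_right]
    lia

lemma coeff_choose_two_pentagonalSeries_pow_three (k : ℕ) :
    coeff ((k + 1).choose 2) (pentagonalSeries ℤ ^ 3) = (-1) ^ k * (2 * k + 1 : ℤ) := by
  rw [coeff_pentagonalSeries_pow_three, sum_eq_single k]
  · simp
  · intro i _ hi
    rw [if_neg (strictMono_choose_two.injective.ne hi)]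
  · intro h
    have := le_choose_two k
    simp at h
    lia

lemma coeff_pentagonalSeries_pow_three_eq_zero (n : ℕ)
    (h : n ∉ Set.range fun k : ℕ ↦ (k + 1).choose 2) : coeff n (pentagonalSeries ℤ ^ 3) = 0 := by
  rw [coeff_pentagonalSeries_pow_three]
  exact sum_eq_zero fun k _ ↦ if_neg fun hk ↦ h ⟨k, hk⟩

lemma two_mul_choose_two (k : ℕ) : 2 * (k + 1).choose 2 = (k + 1) * k := by
  rw [Nat.choose_two_right, Nat.add_sub_cancel]
  exact Nat.mul_div_cancel' (by rw [mul_comm]; exact (Nat.even_mul_succ_self k).two_dvd)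

lemma choose_two_mod_five (k : ℕ) : (k + 1).choose 2 % 5 ≠ 2 := by
  have h := two_mul_choose_two k
  have h1 : (2 * (k + 1).choose 2) % 5 = ((k % 5 + 1) * (k % 5)) % 5 := by
    rw [h]; simp [Nat.mul_mod, Nat.add_mod]
  have : k % 5 < 5 := Nat.mod_lt _ (by simp)
  interval_cases k % 5 <;> lia

lemma choose_two_mod_seven (k : ℕ) : (k + 1).choose 2 % 7 ≠ 2 ∧ (k + 1).choose 2 % 7 ≠ 4 ∧
    (k + 1).choose 2 % 7 ≠ 5 ∧ ((k + 1).choose 2 % 7 = 6 → k % 7 = 3) := by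
  have h := two_mul_choose_two k
  have h1 : (2 * (k + 1).choose 2) % 7 = ((k % 7 + 1) * (k % 7)) % 7 := by
    rw [h]; simp [Nat.mul_mod, Nat.add_mod]
  have : k % 7 < 7 := Nat.mod_lt _ (by simp)
  interval_cases k % 7 <;> lia

lemma residuePart_pentagonalSeries_pow_three {m r : ℕ}
    (h : ∀ k : ℕ, (k + 1).choose 2 % m ≠ r % m) :
    residuePart m r (pentagonalSeries ℤ ^ 3) = 0 := by
  ext n
  rw [coeff_residuePart, map_zero]
  split_ifs with hn
  · refine coeff_pentagonalSeries_pow_three_eq_zero n ?_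
    rintro ⟨k, rfl⟩
    exact h k hn
  · rfl

lemma residuePart_seven_pentagonalSeries_pow_three (h7 : 7 ≠ 0) :
    residuePart 7 6 (pentagonalSeries ℤ ^ 3) =
      ((-7 : ℤ) : ℤ⟦X⟧) * (X ^ 6 * expand 7 h7 (expand 7 h7 (pentagonalSeries ℤ ^ 3))) := by
  refine residuePart_eq_of_lacunary h7 coeff_choose_two_pentagonalSeries_pow_three
    coeff_pentagonalSeries_pow_three_eq_zero (fun m ↦ 7 * m + 3) (fun m ↦ ?_) (fun m ↦ ?_)
    (fun k hk ↦ ?_)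
  · have h1 := two_mul_choose_two (7 * m + 3)
    have h2 := two_mul_choose_two m
    lia
  · rw [pow_add, pow_mul]
    push_cast
    norm_num
    ring
  · have := (choose_two_mod_seven k).2.2.2 hk
    exact ⟨k / 7, by lia⟩

lemma pentagonal_mod_five (k : ℤ) : (pentagonal k % 5 = 1 ∧ k % 5 = 1) ∨
    pentagonal k % 5 = 0 ∨ pentagonal k % 5 = 2 := by
  have h := two_mul_natCast_pentagonal k
  have h1 : (2 * (pentagonal k : ℤ)) % 5 = (k % 5 * (3 * (k % 5) - 1)) % 5 := by
    rw [h]; simp [Int.mul_emod, Int.sub_emod]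
  have : 0 ≤ k % 5 := Int.emod_nonneg _ (by simp)
  have : k % 5 < 5 := Int.emod_lt_of_pos _ (by simp)
  interval_cases k % 5 <;> lia

lemma pentagonal_mod_seven (k : ℤ) : (pentagonal k % 7 = 2 ∧ k % 7 = 6) ∨
    pentagonal k % 7 = 0 ∨ pentagonal k % 7 = 1 ∨ pentagonal k % 7 = 5 := by
  have h := two_mul_natCast_pentagonal k
  have h1 : (2 * (pentagonal k : ℤ)) % 7 = (k % 7 * (3 * (k % 7) - 1)) % 7 := by
    rw [h]; simp [Int.mul_emod, Int.sub_emod]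
  have : 0 ≤ k % 7 := Int.emod_nonneg _ (by simp)
  have : k % 7 < 7 := Int.emod_lt_of_pos _ (by simp)
  interval_cases k % 7 <;> lia

lemma residuePart_five_pentagonalSeries (h5 : 5 ≠ 0) : residuePart 5 1 (pentagonalSeries ℤ) =
    ((-1 : ℤ) : ℤ⟦X⟧) * (X ^ 1 * expand 5 h5 (expand 5 h5 (pentagonalSeries ℤ))) := by
  refine residuePart_eq_of_lacunary h5 (coeff_pentagonalSeries_pentagonal ℤ)
    (fun n ↦ coeff_pentagonalSeries_eq_zero ℤ) (fun m ↦ 1 - 5 * m) (fun m ↦ ?_) (fun m ↦ ?_)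
    (fun k hk ↦ ?_)
  · have h1 := two_mul_natCast_pentagonal (1 - 5 * m)
    have h2 := two_mul_natCast_pentagonal m
    lia
  · rcases Int.even_or_odd m with h | h
    · have : Odd (1 - 5 * m) := by grind
      simp [h, this]
    · have : Even (1 - 5 * m) := by grind
      simp [h, this]
  · have := pentagonal_mod_five k
    exact ⟨(1 - k) / 5, by lia⟩

lemma residuePart_seven_pentagonalSeries (h7 : 7 ≠ 0) : residuePart 7 2 (pentagonalSeries ℤ) =
    ((-1 : ℤ) : ℤ⟦X⟧) * (X ^ 2 * expand 7 h7 (expand 7 h7 (pentagonalSeries ℤ))) := by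
  refine residuePart_eq_of_lacunary h7 (coeff_pentagonalSeries_pentagonal ℤ)
    (fun n ↦ coeff_pentagonalSeries_eq_zero ℤ) (fun m ↦ 7 * m - 1) (fun m ↦ ?_) (fun m ↦ ?_)
    (fun k hk ↦ ?_)
  · have h1 := two_mul_natCast_pentagonal (7 * m - 1)
    have h2 := two_mul_natCast_pentagonal m
    lia
  · rcases Int.even_or_odd m with h | h
    · have : Odd (7 * m - 1) := by grind
      simp [h, this]
    · have : Even (7 * m - 1) := by grind
      simp [h, this]
  · have := pentagonal_mod_seven k
    exact ⟨(k + 1) / 7, by lia⟩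

end residues

section dissections

instance {R : Type*} [CommRing R] [CharZero R] : CharZero R⟦X⟧ := constantCoeff.charZero

lemma hasResidue_X_pow_mul_expand {ℓ : ℕ} (hℓ : ℓ ≠ 0) (d : ℕ) (f : ℤ⟦X⟧) :
    HasResidue ℓ d (X ^ d * expand ℓ hℓ f) := by
  intro n hn
  rw [coeff_X_pow_mul'] at hn
  split_ifs at hn with h
  · rw [coeff_expand] at hn
    split_ifs at hn with h1
    · exact ((Nat.modEq_iff_dvd' h).mpr h1).symm
    · exact absurd rfl hn
  · exact absurd rfl hn

lemma coeff_zero_pentagonalSeries : coeff 0 (pentagonalSeries ℤ) = 1 := by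
  simpa [pentagonal_def] using coeff_pentagonalSeries_pentagonal ℤ 0

lemma residuePart_pentagonalSeries_ne_zero (m : ℕ) :
    residuePart m 0 (pentagonalSeries ℤ) ≠ 0 := by
  intro h
  simpa [coeff_residuePart, coeff_zero_pentagonalSeries] using congrArg (coeff 0) h

theorem exists_five_dissection (h5 : 5 ≠ 0) {F : ℤ⟦X⟧}
    (hF : F = X ^ 1 * expand 5 h5 (expand 5 h5 (pentagonalSeries ℤ))) :
    ∃ A B : ℤ⟦X⟧, HasResidue 5 0 A ∧ HasResidue 5 2 B ∧ pentagonalSeries ℤ = A + B - F ∧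
      A * B = -F ^ 2 := by
  have hA := hasResidue_residuePart 5 0 (pentagonalSeries ℤ)
  have hB := hasResidue_residuePart 5 2 (pentagonalSeries ℤ)
  have hFr : HasResidue 5 1 F := hF ▸ hasResidue_X_pow_mul_expand h5 1 _
  have hA0 := residuePart_pentagonalSeries_ne_zero 5
  have hsum : pentagonalSeries ℤ = residuePart 5 0 (pentagonalSeries ℤ) +
      residuePart 5 2 (pentagonalSeries ℤ) - F := by
    have h1 : residuePart 5 1 (pentagonalSeries ℤ) = -F := by
      rw [residuePart_five_pentagonalSeries h5, hF]; simp
    rw [sub_eq_add_neg, ← h1]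
    ext n
    simp only [map_add, coeff_residuePart]
    by_cases hn : n ∈ Set.range pentagonal
    · obtain ⟨k, rfl⟩ := hn
      obtain h | h | h := pentagonal_mod_five k <;> simp [h]
    · simp [coeff_pentagonalSeries_eq_zero ℤ hn]
  have h0 := residuePart_pentagonalSeries_pow_three (m := 5) (r := 2) choose_two_mod_five
  generalize residuePart 5 0 (pentagonalSeries ℤ) = A at *
  generalize residuePart 5 2 (pentagonalSeries ℤ) = B at *
  refine ⟨A, B, hA, hB, hsum, ?_⟩
  have h1 : pentagonalSeries ℤ ^ 3 = A * A * A + B * B * B - F * F * F +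
      (3 : ℤ) • (A * A * B - A * A * F + A * B * B + A * F * F - B * B * F + B * F * F) -
      (6 : ℤ) • (A * B * F) := by
    rw [hsum]
    simp only [zsmul_eq_mul]
    push_cast
    ring
  rw [h1] at h0
  simp only [map_add, map_sub, map_zsmul, residuePart_mul_mul hA hA hA,
    residuePart_mul_mul hB hB hB,
    residuePart_mul_mul hFr hFr hFr, residuePart_mul_mul hA hA hB, residuePart_mul_mul hA hA hFr,
    residuePart_mul_mul hA hB hB, residuePart_mul_mul hA hFr hFr, residuePart_mul_mul hB hB hFr,
    residuePart_mul_mul hB hFr hFr, residuePart_mul_mul hA hB hFr] at h0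
  norm_num at h0
  have h2 : 3 * A * (A * B + F ^ 2) = 0 := by linear_combination h0
  linear_combination (mul_eq_zero.mp h2).resolve_left (mul_ne_zero (OfNat.ofNat_ne_zero 3) hA0)

theorem exists_seven_dissection (h7 : 7 ≠ 0) {F : ℤ⟦X⟧}
    (hF : F = X ^ 2 * expand 7 h7 (expand 7 h7 (pentagonalSeries ℤ))) :
    ∃ A B C : ℤ⟦X⟧, HasResidue 7 0 A ∧ HasResidue 7 1 B ∧ HasResidue 7 5 C ∧
      pentagonalSeries ℤ = A + B + C - F ∧ A * B * C = -F ^ 3 ∧ F ^ 2 * C = A ^ 2 * F - A * B ^ 2 ∧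
      F ^ 2 * A = B ^ 2 * F - B * C ^ 2 ∧ F ^ 2 * B = C ^ 2 * F - C * A ^ 2 := by
  have hA := hasResidue_residuePart 7 0 (pentagonalSeries ℤ)
  have hB := hasResidue_residuePart 7 1 (pentagonalSeries ℤ)
  have hC := hasResidue_residuePart 7 5 (pentagonalSeries ℤ)
  have hFr : HasResidue 7 2 F := hF ▸ hasResidue_X_pow_mul_expand h7 2 _
  have hsum : pentagonalSeries ℤ = residuePart 7 0 (pentagonalSeries ℤ) +
      residuePart 7 1 (pentagonalSeries ℤ) + residuePart 7 5 (pentagonalSeries ℤ) - F := by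
    have h1 : residuePart 7 2 (pentagonalSeries ℤ) = -F := by
      rw [residuePart_seven_pentagonalSeries h7, hF]; simp
    rw [sub_eq_add_neg, ← h1]
    ext n
    simp only [map_add, coeff_residuePart]
    by_cases hn : n ∈ Set.range pentagonal
    · obtain ⟨k, rfl⟩ := hn
      obtain h | h | h | h := pentagonal_mod_seven k <;> simp [h]
    · simp [coeff_pentagonalSeries_eq_zero ℤ hn]
  have h2 := residuePart_pentagonalSeries_pow_three (m := 7) (r := 2)
    fun k ↦ (choose_two_mod_seven k).1
  have h4 := residuePart_pentagonalSeries_pow_three (m := 7) (r := 4)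
    fun k ↦ (choose_two_mod_seven k).2.1
  have h5 := residuePart_pentagonalSeries_pow_three (m := 7) (r := 5)
    fun k ↦ (choose_two_mod_seven k).2.2.1
  have h6 : residuePart 7 6 (pentagonalSeries ℤ ^ 3) = -7 * F ^ 3 := by
    rw [residuePart_seven_pentagonalSeries_pow_three h7, hF]
    simp only [map_pow]
    push_cast
    ring
  generalize residuePart 7 0 (pentagonalSeries ℤ) = A at *
  generalize residuePart 7 1 (pentagonalSeries ℤ) = B at *
  generalize residuePart 7 5 (pentagonalSeries ℤ) = C at *
  have h1 : pentagonalSeries ℤ ^ 3 = A * A * A + B * B * B + C * C * C - F * F * F +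
      (3 : ℤ) • (A * A * B + A * A * C - A * A * F + A * B * B + B * B * C - B * B * F +
        A * C * C + B * C * C - C * C * F + A * F * F + B * F * F + C * F * F) +
      (6 : ℤ) • (A * B * C - A * B * F - A * C * F - B * C * F) := by
    rw [hsum]
    simp only [zsmul_eq_mul]
    push_cast
    ring
  rw [h1] at h2 h4 h5 h6
  simp only [map_add, map_sub, map_zsmul, residuePart_mul_mul hA hA hA,
    residuePart_mul_mul hB hB hB,
    residuePart_mul_mul hC hC hC, residuePart_mul_mul hFr hFr hFr, residuePart_mul_mul hA hA hB,
    residuePart_mul_mul hA hA hC, residuePart_mul_mul hA hA hFr, residuePart_mul_mul hA hB hB,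
    residuePart_mul_mul hB hB hC, residuePart_mul_mul hB hB hFr, residuePart_mul_mul hA hC hC,
    residuePart_mul_mul hB hC hC, residuePart_mul_mul hC hC hFr, residuePart_mul_mul hA hFr hFr,
    residuePart_mul_mul hB hFr hFr, residuePart_mul_mul hC hFr hFr, residuePart_mul_mul hA hB hC,
    residuePart_mul_mul hA hB hFr, residuePart_mul_mul hA hC hFr,
    residuePart_mul_mul hB hC hFr] at h2 h4 h5 h6
  norm_num at h2 h4 h5 h6
  refine ⟨A, B, C, hA, hB, hC, hsum, ?_, ?_, ?_, ?_⟩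
  · apply mul_left_cancel₀ (OfNat.ofNat_ne_zero 6)
    linear_combination h6
  · apply mul_left_cancel₀ (OfNat.ofNat_ne_zero 3)
    linear_combination h2
  · apply mul_left_cancel₀ (OfNat.ofNat_ne_zero 3)
    linear_combination h4
  · apply mul_left_cancel₀ (OfNat.ofNat_ne_zero 3)
    linear_combination h5

end dissections

section norms

variable {ω : ℂ} {ℓ : ℕ}

/-- The product of the series `f (ω ^ i X)` over `i < ℓ`. -/
noncomputable def rootNorm (ω : ℂ) (ℓ : ℕ) : ℂ⟦X⟧ →* ℂ⟦X⟧ where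
  toFun f := ∏ i ∈ range ℓ, rescale (ω ^ i) f
  map_one' := by simp
  map_mul' f g := by simp [prod_mul_distrib]

lemma rootNorm_apply (f : ℂ⟦X⟧) : rootNorm ω ℓ f = ∏ i ∈ range ℓ, rescale (ω ^ i) f := rfl

lemma prod_one_sub_pow_mul {R : Type*} [CommRing R] [IsDomain R] {ζ : R} (hζ : IsPrimitiveRoot ζ ℓ)
    (hℓ : 0 < ℓ) (x : R) : ∏ i ∈ range ℓ, (1 - ζ ^ i * x) = 1 - x ^ ℓ := by
  simpa [Polynomial.eval_prod] using
    (congrArg (Polynomial.eval 1) (X_pow_sub_C_eq_prod hζ hℓ (rfl : x ^ ℓ = x ^ ℓ))).symm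

lemma rootNorm_one_sub_X_pow (hω : IsPrimitiveRoot ω ℓ) (hℓ : 0 < ℓ) {m : ℕ}
    (hm : m.Coprime ℓ) : rootNorm ω ℓ (1 - X ^ m) = 1 - X ^ (ℓ * m) := by
  have h1 : IsPrimitiveRoot (C (ω ^ m) : ℂ⟦X⟧) ℓ :=
    (hω.pow_of_coprime m hm).map_of_injective C_injective
  rw [mul_comm, pow_mul, ← prod_one_sub_pow_mul h1 hℓ, rootNorm_apply]
  refine prod_congr rfl fun i _ ↦ ?_
  rw [map_sub, map_one, map_pow, rescale_X, mul_pow, ← map_pow, ← map_pow, ← pow_mul, ← pow_mul,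
    mul_comm i]

lemma rootNorm_one_sub_X_pow_mul (hω : ω ^ ℓ = 1) (m : ℕ) :
    rootNorm ω ℓ (1 - X ^ (ℓ * m)) = (1 - X ^ (ℓ * m)) ^ ℓ := by
  rw [rootNorm_apply, ← card_range ℓ, ← prod_const, card_range]
  refine prod_congr rfl fun i _ ↦ ?_
  rw [map_sub, map_one, map_pow, rescale_X, mul_pow, ← map_pow, ← pow_mul, mul_left_comm, pow_mul,
    hω, one_pow, map_one, one_mul]

lemma rootNorm_eulerProd (hω : IsPrimitiveRoot ω ℓ) (hp : ℓ.Prime) (M : ℕ) :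
    rootNorm ω ℓ (map (Int.castRingHom ℂ) (eulerProd (ℓ * M))) *
      map (Int.castRingHom ℂ) (expand ℓ hp.ne_zero (expand ℓ hp.ne_zero (eulerProd M))) =
    map (Int.castRingHom ℂ) (expand ℓ hp.ne_zero (eulerProd (ℓ * M)) *
      expand ℓ hp.ne_zero (eulerProd M) ^ ℓ) := by
  induction M with
  | zero => simp [eulerProd]
  | succ M ih =>
    obtain ⟨k, rfl⟩ : ∃ k, ℓ = k + 1 := ⟨ℓ - 1, by have := hp.pos; lia⟩
    have h1 : eulerProd ((k + 1) * (M + 1)) = eulerProd ((k + 1) * M) *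
        (∏ i ∈ range k, (1 - X ^ ((k + 1) * M + i + 1))) * (1 - X ^ ((k + 1) * (M + 1))) := by
      rw [show (k + 1) * (M + 1) = (k + 1) * M + k + 1 by ring, eulerProd_succ, eulerProd,
        prod_range_add, eulerProd]
    have h2 : rootNorm ω (k + 1) (∏ i ∈ range k, (1 - X ^ ((k + 1) * M + i + 1))) =
        ∏ i ∈ range k, (1 - X ^ ((k + 1) * ((k + 1) * M + i + 1))) := by
      rw [map_prod]
      refine prod_congr rfl fun i hi ↦ rootNorm_one_sub_X_pow hω (by lia) ?_
      rw [Nat.coprime_comm, hp.coprime_iff_not_dvd, add_assoc, Nat.dvd_add_right ⟨M, rfl⟩]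
      intro h
      have := Nat.le_of_dvd (by lia) h
      have := Finset.mem_range.mp hi
      lia
    have h3 := rootNorm_one_sub_X_pow_mul hω.pow_eq_one (M + 1)
    rw [h1, eulerProd_succ]
    simp only [map_mul, map_prod, map_sub, map_one, map_pow, map_X, expand_X] at ih h2 h3 ⊢
    simp only [← pow_mul] at ih h2 h3 ⊢
    rw [h2, h3, mul_pow]
    linear_combination (∏ i ∈ range k, (1 - X ^ ((k + 1) * ((k + 1) * M + i + 1)) : ℂ⟦X⟧)) *
      (1 - X ^ ((k + 1) * (M + 1))) ^ (k + 1) * (1 - X ^ ((k + 1) * ((k + 1) * (M + 1)))) * ih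

lemma X_pow_dvd_expand {R : Type*} [CommRing R] {n : ℕ} {f : R⟦X⟧} (hℓ : ℓ ≠ 0) (h : X ^ n ∣ f) :
    X ^ n ∣ expand ℓ hℓ f := by
  obtain ⟨g, rfl⟩ := h
  rw [map_mul, map_pow, expand_X, ← pow_mul]
  exact (pow_dvd_pow _ (Nat.le_mul_of_pos_left n (by lia))).mul_right _

lemma X_pow_dvd_rescale {R : Type*} [CommRing R] {n : ℕ} {f : R⟦X⟧} (a : R) (h : X ^ n ∣ f) :
    X ^ n ∣ rescale a f := by
  obtain ⟨g, rfl⟩ := h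
  rw [map_mul, map_pow, rescale_X, mul_pow, mul_assoc, mul_left_comm]
  exact dvd_mul_right _ _

lemma eq_of_forall_X_pow_dvd_sub {R : Type*} [CommRing R] {f g : R⟦X⟧}
    (h : ∀ n, X ^ (n + 1) ∣ f - g) : f = g := by
  ext n
  simpa [sub_eq_zero] using X_pow_dvd_iff.mp (h n) n (by lia)

theorem rootNorm_pentagonalSeries (hω : IsPrimitiveRoot ω ℓ) (hp : ℓ.Prime) :
    rootNorm ω ℓ (map (Int.castRingHom ℂ) (pentagonalSeries ℤ)) *
      map (Int.castRingHom ℂ) (expand ℓ hp.ne_zero (expand ℓ hp.ne_zero (pentagonalSeries ℤ))) =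
    map (Int.castRingHom ℂ) (expand ℓ hp.ne_zero (pentagonalSeries ℤ)) ^ (ℓ + 1) := by
  refine eq_of_forall_X_pow_dvd_sub fun n ↦ ?_
  have h1 := X_pow_dvd_pentagonalSeries_sub n
  have h2 := (pow_dvd_pow _ (Nat.succ_le_succ (Nat.le_mul_of_pos_left n hp.pos))).trans
    (X_pow_dvd_pentagonalSeries_sub (ℓ * n))
  have hmap {f : ℤ⟦X⟧} (h : X ^ (n + 1) ∣ f) :
      (X : ℂ⟦X⟧) ^ (n + 1) ∣ map (Int.castRingHom ℂ) f := by
    simpa using map_dvd (map (Int.castRingHom ℂ)) h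
  have h3 (i : ℕ) := X_pow_dvd_rescale (ω ^ i) (hmap h2)
  have h4 := hmap (X_pow_dvd_expand hp.ne_zero (X_pow_dvd_expand hp.ne_zero h1))
  have h5 := hmap (X_pow_dvd_expand hp.ne_zero h1)
  have h6 := hmap (X_pow_dvd_expand hp.ne_zero h2)
  have h7 := rootNorm_eulerProd hω hp n
  simp only [map_sub, map_mul, map_pow, rootNorm_apply] at h3 h4 h5 h6 h7 ⊢
  rw [← Ideal.mem_span_singleton, ← Ideal.Quotient.eq] at h4 h5 h6 ⊢
  simp only [← Ideal.mem_span_singleton, ← Ideal.Quotient.eq] at h3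
  rw [map_mul, map_prod, prod_congr rfl fun i _ ↦ h3 i, ← map_prod, h4, ← map_mul, h7, map_mul,
    map_pow, map_pow, ← h5, ← h6, pow_succ' _ ℓ]

end norms

section newton

variable {R : Type*} [CommRing R] {ℓ n : ℕ} {a c : ℕ → R}

lemma sum_pow_eq_of_degree_le
    (h : ∀ z, ∏ i ∈ range ℓ, (z - a i) = z ^ ℓ - ∑ i ∈ Icc 1 ℓ, c i * z ^ (ℓ - i)) (hn : ℓ ≤ n) :
    ∑ k ∈ range ℓ, a k ^ n = ∑ i ∈ Icc 1 ℓ, c i * ∑ k ∈ range ℓ, a k ^ (n - i) := by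
  simp only [mul_sum]
  rw [sum_comm]
  refine sum_congr rfl fun k hk ↦ ?_
  have h1 := h (a k)
  rw [prod_eq_zero hk (sub_self _), eq_comm, sub_eq_zero] at h1
  rw [← Nat.sub_add_cancel hn, pow_add, h1, mul_sum]
  refine sum_congr rfl fun i hi ↦ ?_
  rw [mul_left_comm, ← pow_add, Nat.sub_add_cancel hn, ← Nat.add_sub_assoc (mem_Icc.mp hi).2,
    Nat.sub_add_cancel hn]

lemma sum_pow_eq_of_lt_degree [IsDomain R] [Infinite R]
    (h : ∀ z, ∏ i ∈ range ℓ, (z - a i) = z ^ ℓ - ∑ i ∈ Icc 1 ℓ, c i * z ^ (ℓ - i)) (hn : 1 ≤ n)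
    (hnℓ : n ≤ ℓ) :
    ∑ k ∈ range ℓ, a k ^ n =
      ∑ i ∈ Ico 1 n, c i * ∑ k ∈ range ℓ, a k ^ (n - i) + n * c n := by
  have hpoly : ((univ.val.map fun i : Fin ℓ ↦ a i).map fun r ↦
      (Polynomial.X - Polynomial.C r)).prod = Polynomial.X ^ ℓ -
        ∑ i ∈ Icc 1 ℓ, Polynomial.C (c i) * Polynomial.X ^ (ℓ - i) := by
    rw [Multiset.map_map]
    change ∏ i : Fin ℓ, (Polynomial.X - Polynomial.C (a i)) = _
    rw [← prod_range fun i ↦ Polynomial.X - Polynomial.C (a i)]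
    refine Polynomial.funext fun z ↦ ?_
    simpa [Polynomial.eval_prod, Polynomial.eval_finsetSum] using h z
  have hesymm (i : ℕ) (hi : 1 ≤ i) (hiℓ : i ≤ ℓ) :
      (-1) ^ i * MvPolynomial.aeval (fun i : Fin ℓ ↦ a i) (MvPolynomial.esymm (Fin ℓ) ℤ i) =
        -c i := by
    have h1 := Multiset.prod_X_sub_C_coeff (univ.val.map fun i : Fin ℓ ↦ a i) (k := ℓ - i)
      (by simp)
    rw [hpoly] at h1
    simp only [Multiset.card_map, card_val, card_univ, Fintype.card_fin,
      Nat.sub_sub_self hiℓ] at h1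
    rw [MvPolynomial.aeval_esymm_eq_multiset_esymm, ← h1, Polynomial.coeff_sub,
      Polynomial.coeff_X_pow, if_neg (by lia), Polynomial.finsetSum_coeff,
      sum_eq_single_of_mem i (mem_Icc.mpr ⟨hi, hiℓ⟩)]
    · simp
    · intro k hk hki
      rw [Polynomial.coeff_C_mul_X_pow, if_neg]
      have := mem_Icc.mp hk
      lia
  have hpsum (m : ℕ) : MvPolynomial.aeval (fun i : Fin ℓ ↦ a i) (MvPolynomial.psum (Fin ℓ) ℤ m) =
      ∑ k ∈ range ℓ, a k ^ m := by
    simp [MvPolynomial.psum, sum_range]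
  have h2 := congrArg (MvPolynomial.aeval fun i : Fin ℓ ↦ a i)
    (MvPolynomial.psum_eq_mul_esymm_sub_sum (Fin ℓ) ℤ n hn)
  have h3 := hesymm n hn hnℓ
  rw [sum_filter, Nat.sum_antidiagonal_eq_sum_range_succ_mk, ← sum_filter] at h2
  simp only [map_sub, map_sum, map_mul, map_pow, map_neg, map_one, map_natCast, hpsum] at h2
  have h4 : (range n.succ).filter (fun i ↦ i ∈ Set.Ioo 0 n) = Ico 1 n := by
    ext i
    simp only [mem_filter, Finset.mem_range, Set.mem_Ioo, mem_Ico]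
    lia
  rw [h2, h4, pow_succ, sub_eq_add_neg, ← sum_neg_distrib, add_comm]
  congr 1
  · refine sum_congr rfl fun i hi ↦ ?_
    have := mem_Ico.mp hi
    rw [hesymm i (by lia) (by lia)]
    ring
  · linear_combination -(n : R) * h3

end newton

section sieve_pow

variable {ω : ℂ} {ℓ : ℕ} {y : ℤ⟦X⟧} {c : ℕ → ℤ⟦X⟧}

lemma sum_rescale_map (hω : IsPrimitiveRoot ω ℓ) (hℓ : ℓ ≠ 0) (f : ℤ⟦X⟧) :
    ∑ i ∈ range ℓ, rescale (ω ^ i) (map (Int.castRingHom ℂ) f) =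
      map (Int.castRingHom ℂ) (expand ℓ hℓ ((ℓ : ℤ⟦X⟧) * sieve ℓ f)) := by
  ext n
  rw [← sieve_natCast_mul, map_sum]
  simp only [coeff_rescale, coeff_map, coeff_expand, coeff_sieve, ← sum_mul]
  split_ifs with h
  · obtain ⟨m, rfl⟩ := h
    rw [Nat.mul_div_cancel_left _ (Nat.pos_of_ne_zero hℓ), sum_congr rfl fun i _ ↦
      show (ω ^ i) ^ (ℓ * m) = 1 by rw [← pow_mul, mul_left_comm, pow_mul, hω.pow_eq_one, one_pow],
      ← nsmul_eq_mul, map_nsmul]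
    simp
  · have h1 : ω ^ n ≠ 1 := fun h1 ↦ h (hω.dvd_of_pow_eq_one n h1)
    have h2 := geom_sum_mul (ω ^ n) ℓ
    rw [← pow_mul, mul_comm n, pow_mul, hω.pow_eq_one, one_pow, sub_self] at h2
    simp only [← pow_mul, mul_comm _ n]
    simp only [pow_mul]
    rw [(mul_eq_zero.mp h2).resolve_right (sub_ne_zero.mpr h1)]
    simp

lemma map_intCast_expand_injective (hℓ : ℓ ≠ 0) {f g : ℤ⟦X⟧}
    (h : map (Int.castRingHom ℂ) (expand ℓ hℓ f) = map (Int.castRingHom ℂ) (expand ℓ hℓ g)) :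
    f = g := by
  ext n
  have := congrArg (coeff (ℓ * n)) h
  simpa [coeff_expand, Nat.pos_of_ne_zero hℓ] using this

lemma sum_rescale_map_pow (hω : IsPrimitiveRoot ω ℓ) (hℓ : ℓ ≠ 0) (n : ℕ) :
    ∑ i ∈ range ℓ, rescale (ω ^ i) (map (Int.castRingHom ℂ) y) ^ n =
      map (Int.castRingHom ℂ) (expand ℓ hℓ ((ℓ : ℤ⟦X⟧) * sieve ℓ (y ^ n))) := by
  simp only [← sum_rescale_map hω, map_pow]

lemma sieve_pow_of_le (hω : IsPrimitiveRoot ω ℓ) (hℓ : ℓ ≠ 0)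
    (h : ∀ z, ∏ i ∈ range ℓ, (z - rescale (ω ^ i) (map (Int.castRingHom ℂ) y)) =
      z ^ ℓ - ∑ i ∈ Icc 1 ℓ, map (Int.castRingHom ℂ) (expand ℓ hℓ (c i)) * z ^ (ℓ - i))
    {n : ℕ} (hn : ℓ ≤ n) :
    sieve ℓ (y ^ n) = ∑ i ∈ Icc 1 ℓ, c i * sieve ℓ (y ^ (n - i)) := by
  have h1 := sum_pow_eq_of_degree_le h hn
  simp only [sum_rescale_map_pow hω hℓ, ← map_mul, ← map_sum] at h1
  have h2 := map_intCast_expand_injective hℓ h1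
  simp only [mul_left_comm _ (ℓ : ℤ⟦X⟧), ← mul_sum] at h2
  exact mul_left_cancel₀ (Nat.cast_ne_zero.mpr hℓ) h2

lemma sieve_pow_of_lt (hω : IsPrimitiveRoot ω ℓ) (hℓ : ℓ ≠ 0)
    (h : ∀ z, ∏ i ∈ range ℓ, (z - rescale (ω ^ i) (map (Int.castRingHom ℂ) y)) =
      z ^ ℓ - ∑ i ∈ Icc 1 ℓ, map (Int.castRingHom ℂ) (expand ℓ hℓ (c i)) * z ^ (ℓ - i))
    {n : ℕ} (hn : 1 ≤ n) (hnℓ : n ≤ ℓ) {d : ℤ⟦X⟧} (hd : c n = ℓ * d) :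
    sieve ℓ (y ^ n) - ∑ i ∈ Ico 1 n, c i * sieve ℓ (y ^ (n - i)) = n * d := by
  have h1 := sum_pow_eq_of_lt_degree h hn hnℓ
  rw [← map_natCast (map (Int.castRingHom ℂ)) n, ← map_natCast (expand ℓ hℓ) n] at h1
  simp only [sum_rescale_map_pow hω hℓ, ← map_mul, ← map_sum, ← map_add] at h1
  have h2 := map_intCast_expand_injective hℓ h1
  simp only [mul_left_comm _ (ℓ : ℤ⟦X⟧), ← mul_sum, hd, ← mul_add] at h2
  rw [mul_left_cancel₀ (Nat.cast_ne_zero.mpr hℓ) h2, add_sub_cancel_left]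

end sieve_pow

section determinants

variable {R : Type*} [CommRing R] {w : R}

lemma prod_range_five (hw : w ^ 5 = 1) (hw' : ∑ i ∈ range 5, w ^ i = 0) (u v x : R) :
    ∏ i ∈ range 5, (u + w ^ (2 * i) * v - w ^ (1 * i) * x) =
      u ^ 5 + v ^ 5 - x ^ 5 + 5 * x ^ 3 * u * v - 5 * x * u ^ 2 * v ^ 2 := by
  have h1 : (u + w ^ 2 * v - w * x) * (u + w ^ 3 * v - w ^ 4 * x) = u ^ 2 + v ^ 2 + x ^ 2 +
      (w ^ 2 + w ^ 3) * (u * v) - (w + w ^ 4) * ((u + v) * x) := by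
    linear_combination (v ^ 2 + x ^ 2 - v * x * w) * hw
  have h2 : (u + w ^ 4 * v - w ^ 2 * x) * (u + w * v - w ^ 3 * x) = u ^ 2 + v ^ 2 + x ^ 2 +
      (w + w ^ 4) * (u * v) - (w ^ 2 + w ^ 3) * ((u + v) * x) := by
    linear_combination (v ^ 2 + x ^ 2 - v * x * w ^ 2) * hw
  simp only [prod_range_succ, prod_range_zero, sum_range_succ, sum_range_zero] at hw' ⊢
  norm_num at hw' ⊢
  have h6 : w ^ 6 = w := by linear_combination w * hw
  have h8 : w ^ 8 = w ^ 3 := by linear_combination w ^ 3 * hw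
  rw [h6, h8]
  have h3 : w + w ^ 4 = -1 - (w ^ 2 + w ^ 3) := by linear_combination hw'
  have h4 : (w ^ 2 + w ^ 3) ^ 2 = 1 - (w ^ 2 + w ^ 3) := by
    linear_combination (w + 2) * hw + hw'
  rw [h3] at h1 h2
  generalize w ^ 2 + w ^ 3 = φ at *
  linear_combination (u + v - x) * ((u + w ^ 4 * v - w ^ 2 * x) * (u + w * v - w ^ 3 * x)) * h1 +
    (u + v - x) * (u ^ 2 + v ^ 2 + x ^ 2 + φ * (u * v) + (1 + φ) * ((u + v) * x)) * h2 -
    (u + v - x) * (u * v + (u + v) * x) ^ 2 * h4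

lemma prod_range_seven (hw : w ^ 7 = 1) (hw' : ∑ i ∈ range 7, w ^ i = 0) (u v s x : R) :
    ∏ i ∈ range 7, (u + w ^ (1 * i) * v + w ^ (5 * i) * s - w ^ (2 * i) * x) =
      u ^ 7 + v ^ 7 + s ^ 7 - x ^ 7 + 14 * x ^ 4 * u * v * s +
      7 * x ^ 3 * (u ^ 3 * v + v ^ 3 * s + s ^ 3 * u) +
      14 * x ^ 2 * (u ^ 2 * v ^ 3 + v ^ 2 * s ^ 3 + s ^ 2 * u ^ 3) +
      7 * x * (u * v ^ 5 + v * s ^ 5 + s * u ^ 5) + 7 * x * (u * v * s) ^ 2 +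
      7 * u * v * s * (u ^ 3 * v + v ^ 3 * s + s ^ 3 * u) := by
  generalize ha : u ^ 3 + v ^ 3 + s ^ 3 - x ^ 3 + 3 * u * v * s = a
  generalize hb : u ^ 2 * v + v ^ 2 * s + s ^ 2 * u - x * (u ^ 2 + v ^ 2 + s ^ 2) -
    x * (u * v + v * s + s * u) + u * v * s = b
  generalize hc : u ^ 2 * s + v ^ 2 * u + s ^ 2 * v + x ^ 2 * (u + v + s) -
    x * (u * v + v * s + s * u) = c
  have h1 : (u + w * v + w ^ 5 * s - w ^ 2 * x) * (u + w ^ 2 * v + w ^ 3 * s - w ^ 4 * x) *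
      (u + w ^ 4 * v + w ^ 6 * s - w * x) =
      a + (w + w ^ 2 + w ^ 4) * b + (w ^ 3 + w ^ 5 + w ^ 6) * c := by
    subst ha hb hc
    grind
  have h2 : (u + w ^ 3 * v + w * s - w ^ 6 * x) * (u + w ^ 5 * v + w ^ 4 * s - w ^ 3 * x) *
      (u + w ^ 6 * v + w ^ 2 * s - w ^ 5 * x) =
      a + (w ^ 3 + w ^ 5 + w ^ 6) * b + (w + w ^ 2 + w ^ 4) * c := by
    subst ha hb hc
    grind
  have hpow : ∀ n, w ^ (n + 7) = w ^ n := fun n ↦ by rw [pow_add, hw, mul_one]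
  simp only [prod_range_succ, prod_range_zero, sum_range_succ, sum_range_zero] at hw' ⊢
  norm_num at hw' ⊢
  simp only [hpow 1, hpow 2, hpow 3, hpow 4, hpow 5, hpow 6, hpow 8, hpow 9, hpow 11, hpow 13,
    hpow 16, hpow 18, hpow 23, pow_one]
  have h3 : w ^ 3 + w ^ 5 + w ^ 6 = -1 - (w + w ^ 2 + w ^ 4) := by linear_combination hw'
  have h4 : (w + w ^ 2 + w ^ 4) ^ 2 = -2 - (w + w ^ 2 + w ^ 4) := by
    linear_combination w * hw + 2 * hw'
  rw [h3] at h1 h2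
  generalize w + w ^ 2 + w ^ 4 = φ at *
  have h5 : (a + φ * b + (-1 - φ) * c) * (a + (-1 - φ) * b + φ * c) =
      a ^ 2 - a * (b + c) + 2 * b ^ 2 + 2 * c ^ 2 - 3 * b * c := by
    linear_combination -(b - c) ^ 2 * h4
  rw [← h1, ← h2] at h5
  trans (u + v + s - x) * (a ^ 2 - a * (b + c) + 2 * b ^ 2 + 2 * c ^ 2 - 3 * b * c)
  · rw [← h5]
    ac_rfl
  · subst ha hb hc
    ring

end determinants

section modular_equations

variable {ω : ℂ} {ℓ : ℕ}

lemma HasResidue.rescale_map {r : ℕ} {f : ℤ⟦X⟧} (hω : ω ^ ℓ = 1) (h : HasResidue ℓ r f) (i : ℕ) :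
    rescale (ω ^ i) (map (Int.castRingHom ℂ) f) =
      C ω ^ (r * i) * map (Int.castRingHom ℂ) f := by
  ext n
  rw [coeff_rescale, ← map_pow, coeff_C_mul, coeff_map]
  by_cases hn : coeff n f = 0
  · simp [hn]
  · have hi : (ω ^ i) ^ ℓ = 1 := by rw [← pow_mul, mul_comm, pow_mul, hω, one_pow]
    rw [mul_comm r, pow_mul, pow_eq_pow_mod n hi, h n hn, ← pow_eq_pow_mod r hi]

lemma sum_range_C_pow (hω : IsPrimitiveRoot ω ℓ) (hℓ : 1 < ℓ) :
    ∑ i ∈ range ℓ, (C ω : ℂ⟦X⟧) ^ i = 0 :=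
  (hω.map_of_injective C_injective).geom_sum_eq_zero hℓ

lemma expand_partitionSeries_mul (hℓ : ℓ ≠ 0) :
    map (Int.castRingHom ℂ) (expand ℓ hℓ (pentagonalSeries ℤ)) *
      map (Int.castRingHom ℂ) (expand ℓ hℓ partitionSeries) = 1 := by
  rw [← map_mul, ← map_mul, pentagonalSeries_mul_partitionSeries, map_one, map_one]

lemma rootNorm_pentagonalSeries_ne_zero (hω : IsPrimitiveRoot ω ℓ) (hp : ℓ.Prime) :
    rootNorm ω ℓ (map (Int.castRingHom ℂ) (pentagonalSeries ℤ)) ≠ 0 := by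
  intro h
  have h1 := rootNorm_pentagonalSeries hω hp
  have h2 := expand_partitionSeries_mul hp.ne_zero
  rw [h, zero_mul, eq_comm, pow_eq_zero_iff (by simp)] at h1
  simp [h1] at h2

lemma prod_sub_rescale_mul_rootNorm {d : ℕ} {y F : ℤ⟦X⟧} (hω : ω ^ ℓ = 1) (hF : HasResidue ℓ d F)
    (hy : y = F * partitionSeries) (z : ℂ⟦X⟧) :
    (∏ i ∈ range ℓ, (z - rescale (ω ^ i) (map (Int.castRingHom ℂ) y))) *
      rootNorm ω ℓ (map (Int.castRingHom ℂ) (pentagonalSeries ℤ)) =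
    ∏ i ∈ range ℓ, (z * rescale (ω ^ i) (map (Int.castRingHom ℂ) (pentagonalSeries ℤ)) -
      C ω ^ (d * i) * map (Int.castRingHom ℂ) F) := by
  rw [rootNorm_apply, ← prod_mul_distrib]
  refine prod_congr rfl fun i _ ↦ ?_
  rw [← hF.rescale_map hω, sub_mul, ← map_mul, ← map_mul, hy, mul_assoc,
    mul_comm partitionSeries, pentagonalSeries_mul_partitionSeries, mul_one]

/-- The coefficients of the modular equation of degree `5`. -/
noncomputable def modularCoeffFive (t : ℤ⟦X⟧) : ℕ → ℤ⟦X⟧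
  | 1 => 25 * t
  | 2 => 25 * t
  | 3 => 15 * t
  | 4 => 5 * t
  | _ => t

theorem prod_sub_rescale_five (hω : IsPrimitiveRoot ω 5) (h5 : 5 ≠ 0) {t y : ℤ⟦X⟧}
    (ht : t = X * expand 5 h5 (pentagonalSeries ℤ) ^ 6 * partitionSeries ^ 6)
    (hy : y = X ^ 1 * expand 5 h5 (expand 5 h5 (pentagonalSeries ℤ)) * partitionSeries)
    (z : ℂ⟦X⟧) :
    ∏ i ∈ range 5, (z - rescale (ω ^ i) (map (Int.castRingHom ℂ) y)) =
      z ^ 5 - ∑ i ∈ Icc 1 5,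
        map (Int.castRingHom ℂ) (expand 5 h5 (modularCoeffFive t i)) * z ^ (5 - i) := by
  obtain ⟨F, hF⟩ : ∃ F, F = X ^ 1 * expand 5 h5 (expand 5 h5 (pentagonalSeries ℤ)) := ⟨_, rfl⟩
  have hFr : HasResidue 5 1 F := hF ▸ hasResidue_X_pow_mul_expand h5 1 _
  obtain ⟨A, B, hA, hB, hE, hAB⟩ := exists_five_dissection h5 hF
  have h1 := prod_sub_rescale_mul_rootNorm hω.pow_eq_one hFr (hF ▸ hy) z
  have hN := rootNorm_pentagonalSeries hω Nat.prime_five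
  have hN0 := rootNorm_pentagonalSeries_ne_zero hω Nat.prime_five
  have hP := expand_partitionSeries_mul h5
  have hw : (C ω : ℂ⟦X⟧) ^ 5 = 1 := by rw [← map_pow, hω.pow_eq_one, map_one]
  have hw' := sum_range_C_pow hω (by simp)
  have hEi (i : ℕ) : rescale (ω ^ i) (map (Int.castRingHom ℂ) (pentagonalSeries ℤ)) =
      map (Int.castRingHom ℂ) A + C ω ^ (2 * i) * map (Int.castRingHom ℂ) B -
        C ω ^ (1 * i) * map (Int.castRingHom ℂ) F := by
    rw [hE, map_sub, map_add, map_sub, map_add, hA.rescale_map hω.pow_eq_one,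
      hB.rescale_map hω.pow_eq_one, hFr.rescale_map hω.pow_eq_one, zero_mul, pow_zero, one_mul]
  have hAB' := congrArg (map (Int.castRingHom ℂ)) hAB
  have hT := congrArg (fun f ↦ map (Int.castRingHom ℂ) (expand 5 h5 f)) ht
  have hF' := congrArg (map (Int.castRingHom ℂ)) hF
  have hNE : rootNorm ω 5 (map (Int.castRingHom ℂ) (pentagonalSeries ℤ)) =
      map (Int.castRingHom ℂ) A ^ 5 + map (Int.castRingHom ℂ) B ^ 5 -
        11 * map (Int.castRingHom ℂ) F ^ 5 := by
    rw [rootNorm_apply, prod_congr rfl fun i _ ↦ hEi i, prod_range_five hw hw']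
    simp only [map_mul, map_neg, map_pow] at hAB'
    generalize map (Int.castRingHom ℂ) A = a at *
    generalize map (Int.castRingHom ℂ) B = b at *
    generalize map (Int.castRingHom ℂ) F = f at *
    linear_combination (5 * f ^ 3 - 5 * f * (a * b - f ^ 2)) * hAB'
  have hprod : ∏ i ∈ range 5, (z * rescale (ω ^ i) (map (Int.castRingHom ℂ) (pentagonalSeries ℤ)) -
      C ω ^ (1 * i) * map (Int.castRingHom ℂ) F) =
      z ^ 5 * rootNorm ω 5 (map (Int.castRingHom ℂ) (pentagonalSeries ℤ)) -
        map (Int.castRingHom ℂ) F ^ 5 * (25 * z ^ 4 + 25 * z ^ 3 + 15 * z ^ 2 + 5 * z + 1) := by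
    have := prod_range_five hw hw' (z * map (Int.castRingHom ℂ) A) (z * map (Int.castRingHom ℂ) B)
      ((z + 1) * map (Int.castRingHom ℂ) F)
    rw [hNE, ← prod_congr rfl fun i _ ↦ show z * map (Int.castRingHom ℂ) A +
      C ω ^ (2 * i) * (z * map (Int.castRingHom ℂ) B) -
      C ω ^ (1 * i) * ((z + 1) * map (Int.castRingHom ℂ) F) = _ by rw [hEi]; ring, this]
    simp only [map_mul, map_neg, map_pow] at hAB'
    generalize map (Int.castRingHom ℂ) A = a at *
    generalize map (Int.castRingHom ℂ) B = b at *
    generalize map (Int.castRingHom ℂ) F = f at *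
    linear_combination
      (5 * (z + 1) ^ 3 * f ^ 3 * z ^ 2 - 5 * (z + 1) * z ^ 4 * f * (a * b - f ^ 2)) * hAB'
  have hTN : map (Int.castRingHom ℂ) (expand 5 h5 t) *
      rootNorm ω 5 (map (Int.castRingHom ℂ) (pentagonalSeries ℤ)) =
      map (Int.castRingHom ℂ) F ^ 5 := by
    rw [hT, hF']
    simp only [map_mul, map_pow, map_X, expand_X]
    generalize map (Int.castRingHom ℂ) (expand 5 h5 partitionSeries) = p at *
    generalize map (Int.castRingHom ℂ) (expand 5 h5 (pentagonalSeries ℤ)) = e at *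
    generalize map (Int.castRingHom ℂ) (expand 5 h5 (expand 5 h5 (pentagonalSeries ℤ))) = g at *
    have h2 : (e * p) ^ 6 = 1 := by rw [hP, one_pow]
    linear_combination X ^ 5 * g ^ 5 * p ^ 6 * hN + X ^ 5 * g ^ 5 * h2
  refine mul_right_cancel₀ hN0 ?_
  have hsum (f : ℕ → ℂ⟦X⟧) : ∑ i ∈ Icc 1 5, f i = f 1 + f 2 + f 3 + f 4 + f 5 := by
    simp [sum_Icc_succ_top]
  rw [h1, hprod, ← hTN, hsum]
  simp only [modularCoeffFive, map_mul, map_ofNat, Nat.reduceSub]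
  generalize map (Int.castRingHom ℂ) (expand 5 h5 t) = T
  ring

end modular_equations

section degree_seven

lemma mul_seven_form_eq {R : Type*} [CommRing R] {a b c f : R} (h : a * b * c = -f ^ 3)
    (hc : f ^ 2 * c = a ^ 2 * f - a * b ^ 2) (ha : f ^ 2 * a = b ^ 2 * f - b * c ^ 2)
    (hb : f ^ 2 * b = c ^ 2 * f - c * a ^ 2) {S : R} (hS : a ^ 3 * b + b ^ 3 * c + c ^ 3 * a = S)
    (z x : R) :
    f * ((z * a) ^ 7 + (z * b) ^ 7 + (z * c) ^ 7 - (x * f) ^ 7 +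
      14 * (x * f) ^ 4 * (z * a) * (z * b) * (z * c) +
      7 * (x * f) ^ 3 * ((z * a) ^ 3 * (z * b) + (z * b) ^ 3 * (z * c) + (z * c) ^ 3 * (z * a)) +
      14 * (x * f) ^ 2 * ((z * a) ^ 2 * (z * b) ^ 3 + (z * b) ^ 2 * (z * c) ^ 3 +
        (z * c) ^ 2 * (z * a) ^ 3) +
      7 * (x * f) * ((z * a) * (z * b) ^ 5 + (z * b) * (z * c) ^ 5 + (z * c) * (z * a) ^ 5) +
      7 * (x * f) * ((z * a) * (z * b) * (z * c)) ^ 2 + 7 * (z * a) * (z * b) * (z * c) *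
        ((z * a) ^ 3 * (z * b) + (z * b) ^ 3 * (z * c) + (z * c) ^ 3 * (z * a))) =
      z ^ 7 * (S ^ 2 - 5 * f ^ 4 * S + 9 * f ^ 8) - x ^ 7 * f ^ 8 - 14 * x ^ 4 * z ^ 3 * f ^ 8 +
        7 * x ^ 3 * z ^ 4 * f ^ 4 * S + 14 * x ^ 2 * z ^ 5 * f ^ 4 * (S + 3 * f ^ 4) +
        28 * x * z ^ 6 * f ^ 8 := by
  have h1 : a ^ 2 * b ^ 3 = f * (a ^ 3 * b + f ^ 4) := by
    linear_combination a * b * hc - f ^ 2 * h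
  have h2 : b ^ 2 * c ^ 3 = f * (b ^ 3 * c + f ^ 4) := by
    linear_combination b * c * ha - f ^ 2 * h
  have h3 : c ^ 2 * a ^ 3 = f * (c ^ 3 * a + f ^ 4) := by
    linear_combination c * a * hb - f ^ 2 * h
  have h4 : a * b ^ 5 = f ^ 2 * (a ^ 3 * b + f ^ 4 - b ^ 3 * c) := by
    linear_combination f * h1 + b ^ 3 * hc
  have h5 : b * c ^ 5 = f ^ 2 * (b ^ 3 * c + f ^ 4 - c ^ 3 * a) := by
    linear_combination f * h2 + c ^ 3 * ha
  have h6 : c * a ^ 5 = f ^ 2 * (c ^ 3 * a + f ^ 4 - a ^ 3 * b) := by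
    linear_combination f * h3 + a ^ 3 * hb
  have h7 : f * (a ^ 7 + b ^ 7 + c ^ 7) = S ^ 2 + 2 * f ^ 4 * S + 9 * f ^ 8 := by
    subst hS
    linear_combination f ^ 2 * (h4 + h5 + h6) - a ^ 5 * hc - b ^ 5 * ha - c ^ 5 * hb -
      2 * (a ^ 2 * b ^ 3 + b ^ 2 * c ^ 3 + c ^ 2 * a ^ 3) * h + 2 * f ^ 3 * (h1 + h2 + h3)
  subst hS
  linear_combination z ^ 7 * h7 + 14 * x ^ 4 * f ^ 5 * z ^ 3 * h +
    14 * x ^ 2 * f ^ 3 * z ^ 5 * (h1 + h2 + h3) + 7 * x * f ^ 2 * z ^ 6 * (h4 + h5 + h6) +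
    7 * x * f ^ 2 * z ^ 6 * (a * b * c - f ^ 3) * h +
    7 * f * z ^ 7 * (a ^ 3 * b + b ^ 3 * c + c ^ 3 * a) * h

/-- The coefficients of the modular equation of degree `7`. -/
noncomputable def modularCoeffSeven (t : ℤ⟦X⟧) : ℕ → ℤ⟦X⟧
  | 1 => 49 * t + 343 * t ^ 2
  | 2 => 35 * t + 343 * t ^ 2
  | 3 => 7 * t + 147 * t ^ 2
  | 4 => 49 * t ^ 2
  | 5 => 21 * t ^ 2
  | 6 => 7 * t ^ 2
  | _ => t ^ 2

lemma coeff_one_seven_dissection {A B C F : ℤ⟦X⟧} (hA : HasResidue 7 0 A) (hB : HasResidue 7 1 B)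
    (hC : HasResidue 7 5 C) (hF : HasResidue 7 2 F) (hE : pentagonalSeries ℤ = A + B + C - F) :
    coeff 1 (A ^ 3 * B + B ^ 3 * C + C ^ 3 * A + 8 * F ^ 4) = -1 := by
  have h0 {r k : ℕ} {f : ℤ⟦X⟧} (hf : HasResidue 7 r f) (hr : k % 7 ≠ r % 7) : coeff k f = 0 :=
    by_contra fun h ↦ hr (hf k h)
  have hE0 := congrArg (coeff 0) hE
  have hE1 := congrArg (coeff 1) hE
  have h1 : coeff 1 (pentagonalSeries ℤ) = -1 := by
    simpa [pentagonal_def] using coeff_pentagonalSeries_pentagonal ℤ 1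
  rw [coeff_zero_pentagonalSeries] at hE0
  rw [h1] at hE1
  simp only [map_add, map_sub, h0 hB (k := 0) (by simp), h0 hC (k := 0) (by simp),
    h0 hF (k := 0) (by simp), h0 hA (k := 1) (by simp), h0 hC (k := 1) (by simp),
    h0 hF (k := 1) (by simp)] at hE0 hE1
  have hA0 : constantCoeff A = 1 := by simpa using hE0.symm
  have hB1 : coeff 1 B = -1 := by simpa using hE1.symm
  have hB0 : constantCoeff B = 0 := by simpa using h0 hB (k := 0) (by simp)
  have hC0 : constantCoeff C = 0 := by simpa using h0 hC (k := 0) (by simp)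
  have hF0 : constantCoeff F = 0 := by simpa using h0 hF (k := 0) (by simp)
  simp [coeff_one_mul, coeff_one_pow, hA0, hB0, hC0, hF0, hB1]

theorem prod_sub_rescale_seven {ω : ℂ} (hω : IsPrimitiveRoot ω 7) (h7 : 7 ≠ 0) {t y : ℤ⟦X⟧}
    (ht : t = X * expand 7 h7 (pentagonalSeries ℤ) ^ 4 * partitionSeries ^ 4)
    (hy : y = X ^ 2 * expand 7 h7 (expand 7 h7 (pentagonalSeries ℤ)) * partitionSeries)
    (z : ℂ⟦X⟧) :
    ∏ i ∈ range 7, (z - rescale (ω ^ i) (map (Int.castRingHom ℂ) y)) =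
      z ^ 7 - ∑ i ∈ Icc 1 7,
        map (Int.castRingHom ℂ) (expand 7 h7 (modularCoeffSeven t i)) * z ^ (7 - i) := by
  obtain ⟨F, hF⟩ : ∃ F, F = X ^ 2 * expand 7 h7 (expand 7 h7 (pentagonalSeries ℤ)) := ⟨_, rfl⟩
  have hFr : HasResidue 7 2 F := hF ▸ hasResidue_X_pow_mul_expand h7 2 _
  obtain ⟨A, B, C', hA, hB, hC, hE, hr, hrC, hrA, hrB⟩ := exists_seven_dissection h7 hF
  have hcoeff := coeff_one_seven_dissection hA hB hC hFr hE
  have h1 := prod_sub_rescale_mul_rootNorm hω.pow_eq_one hFr (hF ▸ hy) z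
  have hN := rootNorm_pentagonalSeries hω Nat.prime_seven
  have hN0 := rootNorm_pentagonalSeries_ne_zero hω Nat.prime_seven
  have hP := expand_partitionSeries_mul h7
  have hw : (C ω : ℂ⟦X⟧) ^ 7 = 1 := by rw [← map_pow, hω.pow_eq_one, map_one]
  have hw' := sum_range_C_pow hω (by simp)
  have hEi (i : ℕ) : rescale (ω ^ i) (map (Int.castRingHom ℂ) (pentagonalSeries ℤ)) =
      map (Int.castRingHom ℂ) A + C ω ^ (1 * i) * map (Int.castRingHom ℂ) B +
        C ω ^ (5 * i) * map (Int.castRingHom ℂ) C' - C ω ^ (2 * i) * map (Int.castRingHom ℂ) F := by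
    rw [hE, map_sub, map_add, map_add, map_sub, map_add, map_add, hA.rescale_map hω.pow_eq_one,
      hB.rescale_map hω.pow_eq_one, hC.rescale_map hω.pow_eq_one, hFr.rescale_map hω.pow_eq_one,
      zero_mul, pow_zero, one_mul]
  have hT := congrArg (fun f ↦ map (Int.castRingHom ℂ) (expand 7 h7 f)) ht
  have hF' := congrArg (map (Int.castRingHom ℂ)) hF
  obtain ⟨S, hS⟩ : ∃ S, A ^ 3 * B + B ^ 3 * C' + C' ^ 3 * A = S := ⟨_, rfl⟩
  have hform := mul_seven_form_eq (by simpa using congrArg (map (Int.castRingHom ℂ)) hr)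
    (by simpa using congrArg (map (Int.castRingHom ℂ)) hrC)
    (by simpa using congrArg (map (Int.castRingHom ℂ)) hrA)
    (by simpa using congrArg (map (Int.castRingHom ℂ)) hrB)
    (by simpa using congrArg (map (Int.castRingHom ℂ)) hS)
  have hprod (z x : ℂ⟦X⟧) : map (Int.castRingHom ℂ) F *
      ∏ i ∈ range 7, (z * rescale (ω ^ i) (map (Int.castRingHom ℂ) (pentagonalSeries ℤ)) -
        C ω ^ (2 * i) * (x * map (Int.castRingHom ℂ) F)) =
      z ^ 7 * (map (Int.castRingHom ℂ) S ^ 2 - 5 * map (Int.castRingHom ℂ) F ^ 4 *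
        map (Int.castRingHom ℂ) S + 9 * map (Int.castRingHom ℂ) F ^ 8) -
        (z + x) ^ 7 * map (Int.castRingHom ℂ) F ^ 8 -
        14 * (z + x) ^ 4 * z ^ 3 * map (Int.castRingHom ℂ) F ^ 8 +
        7 * (z + x) ^ 3 * z ^ 4 * map (Int.castRingHom ℂ) F ^ 4 * map (Int.castRingHom ℂ) S +
        14 * (z + x) ^ 2 * z ^ 5 * map (Int.castRingHom ℂ) F ^ 4 *
          (map (Int.castRingHom ℂ) S + 3 * map (Int.castRingHom ℂ) F ^ 4) +
        28 * (z + x) * z ^ 6 * map (Int.castRingHom ℂ) F ^ 8 := by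
    have := hform z (z + x)
    rw [← prod_range_seven hw hw'] at this
    rw [← this]
    congr 1
    refine prod_congr rfl fun i _ ↦ ?_
    rw [hEi]
    ring
  have hNF := hprod 1 0
  simp only [zero_mul, one_mul, mul_zero, sub_zero] at hNF
  rw [← rootNorm_apply] at hNF
  have hQ : map (Int.castRingHom ℂ) (S + 8 * F ^ 4) =
      -map (Int.castRingHom ℂ) (X * expand 7 h7 (pentagonalSeries ℤ) ^ 4) := by
    rw [hS] at hcoeff
    refine (sq_eq_sq_iff_eq_or_eq_neg.mp ?_).resolve_left fun h ↦ ?_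
    · trans map (Int.castRingHom ℂ) F *
        rootNorm ω 7 (map (Int.castRingHom ℂ) (pentagonalSeries ℤ))
      · rw [hNF]
        simp only [map_add, map_mul, map_pow, map_ofNat]
        ring
      · rw [hF']
        simp only [map_mul, map_pow, map_X]
        generalize map (Int.castRingHom ℂ) (expand 7 h7 (expand 7 h7 (pentagonalSeries ℤ))) = g at *
        linear_combination X ^ 2 * hN
    · have h2 := congrArg (coeff 1) h
      rw [coeff_map, coeff_map, hcoeff, coeff_one_mul] at h2
      have hE0 : constantCoeff (pentagonalSeries ℤ) = 1 := by
        simpa using coeff_zero_pentagonalSeries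
      norm_num [hE0] at h2
  have hTN : map (Int.castRingHom ℂ) (expand 7 h7 t) ^ 2 *
      rootNorm ω 7 (map (Int.castRingHom ℂ) (pentagonalSeries ℤ)) =
      map (Int.castRingHom ℂ) F ^ 7 := by
    rw [hT, hF']
    simp only [map_mul, map_pow, map_X, expand_X]
    generalize map (Int.castRingHom ℂ) (expand 7 h7 partitionSeries) = p at *
    generalize map (Int.castRingHom ℂ) (expand 7 h7 (pentagonalSeries ℤ)) = e at *
    generalize map (Int.castRingHom ℂ) (expand 7 h7 (expand 7 h7 (pentagonalSeries ℤ))) = g at *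
    have h2 : (e * p) ^ 8 = 1 := by rw [hP, one_pow]
    linear_combination X ^ 14 * g ^ 7 * p ^ 8 * hN + X ^ 14 * g ^ 7 * h2
  have hTQ : map (Int.castRingHom ℂ) (expand 7 h7 t) *
      map (Int.castRingHom ℂ) (X * expand 7 h7 (pentagonalSeries ℤ) ^ 4) =
      map (Int.castRingHom ℂ) F ^ 4 := by
    rw [hT, hF']
    simp only [map_mul, map_pow, map_X, expand_X]
    generalize map (Int.castRingHom ℂ) (expand 7 h7 partitionSeries) = p at *
    generalize map (Int.castRingHom ℂ) (expand 7 h7 (pentagonalSeries ℤ)) = e at *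
    generalize map (Int.castRingHom ℂ) (expand 7 h7 (expand 7 h7 (pentagonalSeries ℤ))) = g at *
    have h2 : (e * p) ^ 4 = 1 := by rw [hP, one_pow]
    linear_combination X ^ 8 * g ^ 4 * h2
  have hF0 : map (Int.castRingHom ℂ) F ≠ 0 := by
    intro h
    rw [hF', map_mul, map_pow, map_X, mul_eq_zero] at h
    rw [h.resolve_left (pow_ne_zero 2 X_ne_zero), mul_zero, eq_comm,
      pow_eq_zero_iff (by simp)] at hN
    simp [hN] at hP
  refine mul_right_cancel₀ hN0 (mul_left_cancel₀ hF0 ?_)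
  have hsum (f : ℕ → ℂ⟦X⟧) :
      ∑ i ∈ Icc 1 7, f i = f 1 + f 2 + f 3 + f 4 + f 5 + f 6 + f 7 := by
    simp [sum_Icc_succ_top]
  have h2 := hprod z 1
  simp only [one_mul] at h2
  rw [h1, h2, hsum]
  generalize PowerSeries.map (Int.castRingHom ℂ) (X * _) = q at *
  simp only [modularCoeffSeven, map_add, map_mul, map_pow, map_ofNat, Nat.reduceSub] at hQ ⊢
  generalize map (Int.castRingHom ℂ) (expand 7 h7 t) = T at *
  generalize map (Int.castRingHom ℂ) S = s at *
  generalize map (Int.castRingHom ℂ) F = f at *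
  generalize rootNorm _ _ _ = N at *
  have hs : s = -q - 8 * (T * q) := by linear_combination hQ + 8 * hTQ
  have hf8 : f ^ 8 = (T * q) ^ 2 := by rw [hTQ]; ring
  rw [mul_left_comm, hNF, hs, hf8, ← hTQ]
  ring

end degree_seven

section partition

variable {ℓ p δ r : ℕ} {t y : ℤ⟦X⟧} {c : ℕ → ℤ⟦X⟧}

lemma mul_mem_weightSpan_eqnWeight {i : ℕ} {d : ℤ⟦X⟧}
    (hd : d ∈ weightSpan ℓ t (powWeight p i)) :
    (ℓ : ℤ⟦X⟧) * d ∈ weightSpan ℓ t (eqnWeight p i) := by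
  refine weightSpan_map (AddMonoidHom.mulLeft (ℓ : ℤ⟦X⟧)) (fun a j h ↦ ?_) hd
  have := pow_mul_pow_mem_weightSpan (ℓ := ℓ) (t := t) (W := eqnWeight p i) (a := a + 1) (j := j)
    ⟨by have := h.1; omega, h.2⟩
  rwa [pow_succ', mul_assoc] at this

/-- If the conjugates of `y` under `X ↦ ω X` are the roots of a polynomial whose coefficients are
sufficiently divisible by `ℓ`, then powers of `ℓ` divide the coefficients of the powers of the
partition series. -/
theorem pow_dvd_coeff_partitionSeries_pow {ω : ℂ} (hω : IsPrimitiveRoot ω ℓ) (hℓ : ℓ ≠ 0)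
    (hδ : ℓ ^ 2 = 24 * δ + 1) (hr : ℓ + 1 = δ * r) (hp : p = 7 ∧ r = 4 ∨ p = 10 ∧ r = 6)
    (ht : t = X * expand ℓ hℓ (pentagonalSeries ℤ) ^ r * partitionSeries ^ r)
    (hy : y = X ^ δ * expand ℓ hℓ (expand ℓ hℓ (pentagonalSeries ℤ)) * partitionSeries)
    (hroot : ∀ z, ∏ i ∈ range ℓ, (z - rescale (ω ^ i) (map (Int.castRingHom ℂ) y)) =
      z ^ ℓ - ∑ i ∈ Icc 1 ℓ, map (Int.castRingHom ℂ) (expand ℓ hℓ (c i)) * z ^ (ℓ - i))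
    (hc : ∀ i, 1 ≤ i → i < ℓ → ∃ d ∈ weightSpan ℓ t (powWeight p i), c i = ℓ * d)
    (hc' : c ℓ ∈ weightSpan ℓ t (eqnWeight p ℓ))
    {k : ℕ} (hk1 : 1 ≤ k) (hk : k ≤ 2) {N j : ℕ} (hN : 24 * N ≡ k [MOD ℓ ^ j]) :
    (ℓ : ℤ) ^ (j / 2) ∣ coeff N (partitionSeries ^ k) := by
  have hEP := pentagonalSeries_mul_partitionSeries
  have hpow : ∀ n, sieve ℓ (y ^ n) ∈ weightSpan ℓ t (powWeight p n) := by
    refine sieve_pow_mem (c := c) hℓ (fun i hi hiℓ ↦ ?_) (fun n hn hnℓ ↦ ?_)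
      fun n hn ↦ sieve_pow_of_le hω hℓ hroot hn
    · rcases hiℓ.lt_or_eq with h | rfl
      · obtain ⟨d, hd, e⟩ := hc i hi h
        exact e ▸ mul_mem_weightSpan_eqnWeight hd
      · exact hc'
    · obtain ⟨d, hd, e⟩ := hc n hn hnℓ
      rw [sieve_pow_of_lt hω hℓ hroot hn hnℓ.le e, ← nsmul_eq_mul]
      exact nsmul_mem hd n
  have hP : (partitionSeries : ℤ⟦X⟧) ≠ 0 := right_ne_zero_of_mul (hEP ▸ one_ne_zero)
  have hE' : expand ℓ hℓ (pentagonalSeries ℤ) * expand ℓ hℓ partitionSeries = 1 := by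
    rw [← map_mul, hEP, map_one]
  have : NeZero t := ⟨by
    rw [ht]
    exact mul_ne_zero (mul_ne_zero X_ne_zero (pow_ne_zero _ (left_ne_zero_of_mul
      (hE' ▸ one_ne_zero)))) (pow_ne_zero _ hP)⟩
  have hty : expand ℓ hℓ t * t = y ^ r := by
    have hE'r : expand ℓ hℓ (pentagonalSeries ℤ) ^ r * expand ℓ hℓ partitionSeries ^ r = 1 := by
      rw [← mul_pow, hE', one_pow]
    rw [hy, ht]
    simp only [map_mul, map_pow, expand_X, mul_pow, ← pow_mul, ← hr]
    rw [pow_succ]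
    linear_combination X ^ ℓ * X * expand ℓ hℓ (expand ℓ hℓ (pentagonalSeries ℤ)) ^ r *
      partitionSeries ^ r * hE'r
  obtain ⟨h1, h2⟩ := sieve_pow_mul_mem hℓ hp hty hpow
  refine pow_dvd_coeff_of_contraction (G := pentagonalSeries ℤ ^ k) hℓ hδ hk1 hk ?_ ?_ (hpow k) h1
    (h2 k hk) hN
  · rw [← mul_pow, hEP, one_pow]
  · rw [hy, mul_pow, mul_pow, ← pow_mul, map_pow, map_pow]

theorem pow_dvd_coeff_partitionSeries_pow_of_eq (hℓ : ℓ = 5 ∨ ℓ = 7) {k : ℕ} (hk1 : 1 ≤ k)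
    (hk : k ≤ 2) {N j : ℕ} (hN : 24 * N ≡ k [MOD ℓ ^ j]) :
    (ℓ : ℤ) ^ (j / 2) ∣ coeff N (partitionSeries ^ k) := by
  rcases hℓ with rfl | rfl
  · have hω := Complex.isPrimitiveRoot_exp 5 (by norm_num)
    refine pow_dvd_coeff_partitionSeries_pow (p := 10) (δ := 1) (r := 6) hω (by norm_num)
      (by norm_num) (by norm_num) (by norm_num) rfl rfl
      (prod_sub_rescale_five hω _ rfl rfl) (fun i hi hi' ↦ ?_) ?_ hk1 hk hN
    · generalize X * expand 5 _ (pentagonalSeries ℤ) ^ 6 * partitionSeries ^ 6 = t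
      interval_cases i
      · exact ⟨_, int_mul_mem_weightSpan 1 (a := 1) (j := 1) (by norm_num [powWeight]),
          by simp only [modularCoeffFive]; push_cast; ring⟩
      · exact ⟨_, int_mul_mem_weightSpan 1 (a := 1) (j := 1) (by norm_num [powWeight]),
          by simp only [modularCoeffFive]; push_cast; ring⟩
      · exact ⟨_, int_mul_mem_weightSpan 3 (a := 0) (j := 1) (by norm_num [powWeight]),
          by simp only [modularCoeffFive]; push_cast; ring⟩
      · exact ⟨_, int_mul_mem_weightSpan 1 (a := 0) (j := 1) (by norm_num [powWeight]),
          by simp only [modularCoeffFive]; push_cast; ring⟩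
    · simpa [modularCoeffFive] using
        pow_mul_pow_mem_weightSpan (a := 0) (j := 1) (by norm_num [eqnWeight])
  · have hω := Complex.isPrimitiveRoot_exp 7 (by norm_num)
    refine pow_dvd_coeff_partitionSeries_pow (p := 7) (δ := 2) (r := 4) hω (by norm_num)
      (by norm_num) (by norm_num) (by norm_num) rfl rfl
      (prod_sub_rescale_seven hω _ rfl rfl) (fun i hi hi' ↦ ?_) ?_ hk1 hk hN
    · generalize X * expand 7 _ (pentagonalSeries ℤ) ^ 4 * partitionSeries ^ 4 = t
      interval_cases i
      · exact ⟨_, add_mem (int_mul_mem_weightSpan 1 (a := 1) (j := 1) (by norm_num [powWeight]))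
          (int_mul_mem_weightSpan 1 (a := 2) (j := 2) (by norm_num [powWeight])),
          by simp only [modularCoeffSeven]; push_cast; ring⟩
      · exact ⟨_, add_mem (int_mul_mem_weightSpan 5 (a := 0) (j := 1) (by norm_num [powWeight]))
          (int_mul_mem_weightSpan 1 (a := 2) (j := 2) (by norm_num [powWeight])),
          by simp only [modularCoeffSeven]; push_cast; ring⟩
      · exact ⟨_, add_mem (int_mul_mem_weightSpan 1 (a := 0) (j := 1) (by norm_num [powWeight]))
          (int_mul_mem_weightSpan 3 (a := 1) (j := 2) (by norm_num [powWeight])),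
          by simp only [modularCoeffSeven]; push_cast; ring⟩
      · exact ⟨_, int_mul_mem_weightSpan 1 (a := 1) (j := 2) (by norm_num [powWeight]),
          by simp only [modularCoeffSeven]; push_cast; ring⟩
      · exact ⟨_, int_mul_mem_weightSpan 3 (a := 0) (j := 2) (by norm_num [powWeight]),
          by simp only [modularCoeffSeven]; push_cast; ring⟩
      · exact ⟨_, int_mul_mem_weightSpan 1 (a := 0) (j := 2) (by norm_num [powWeight]),
          by simp only [modularCoeffSeven]; push_cast; ring⟩
    · simpa [modularCoeffSeven] using
        pow_mul_pow_mem_weightSpan (a := 0) (j := 2) (by norm_num [eqnWeight])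

end partition

theorem stmt11 (ℓ n j : ℕ) (hℓ : ℓ = 5 ∨ ℓ = 7) (hj : 1 ≤ j)
    (h : 24 * n ≡ 1 [MOD ℓ ^ j]) :
    ℓ ^ (j / 2 - 1) ∣ partp n ∧ ℓ ^ (j / 2 - 1) ∣ partp2 (2 * n) ∧
      ℓ ^ (j / 2 - 1) ∣ (partp n + partp2 (2 * n)) / 2 := by
  have hle : ℓ ^ (j / 2 - 1) ∣ ℓ ^ (j / 2) := pow_dvd_pow _ (Nat.sub_le _ _)
  have h1 : ℓ ^ (j / 2 - 1) ∣ partp n := by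
    have := pow_dvd_coeff_partitionSeries_pow_of_eq hℓ le_rfl one_le_two h
    rw [pow_one, coeff_partitionSeries] at this
    exact hle.trans (by exact_mod_cast this)
  have h2 : ℓ ^ (j / 2 - 1) ∣ partp2 (2 * n) := by
    have h' : 24 * (2 * n) ≡ 2 [MOD ℓ ^ j] := by
      rw [mul_left_comm]
      exact h.mul_left 2
    have := pow_dvd_coeff_partitionSeries_pow_of_eq hℓ one_le_two le_rfl h'
    rw [coeff_partitionSeries_sq] at this
    exact hle.trans (by exact_mod_cast this)
  refine ⟨h1, h2, ?_⟩
  have hodd : Nat.Coprime (ℓ ^ (j / 2 - 1)) 2 := by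
    apply Nat.Coprime.pow_left
    rcases hℓ with rfl | rfl <;> norm_num
  refine hodd.dvd_of_dvd_mul_right ?_
  rw [Nat.div_mul_cancel (even_partp_add_partp2 n).two_dvd]
  exact dvd_add h1 h2
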